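/- arXiv:1308.2281 — 2 statements merged into one kernel-verified Lean document; each statement's English description precedes it below -/
import Mathlib

section
/- Let p, q ≥ 3, k ≥ 1 and n ≥ k−1 be integers, and let G be a bicyclic graph on p+q−1+n vertices that contains an induced subgraph isomorphic to the ∞-graph ∞(p,k,q). If at least one of p and q is even, then the determinant of the distance matrix of G equals 0; and if both p and q are odd, then the determinant of the distance matrix of G equals ((pq−1)(p+q)/4 + (n/2)·p·q)·(−2)^n (as a rational number). -/
open SimpleGraph Matrix

/-- The distance matrix of a graph, with entries in `ℚ`: the `(i,j)` entry is the
graph distance (length of a shortest path) between `i` and `j`. -/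
noncomputable def distMatrix {V : Type*} (G : SimpleGraph V) : Matrix V V ℚ :=
  fun i j => (G.dist i j : ℚ)

/-- The ∞-graph `∞(p,k,q)` on `Fin (p+q+k-2)`: the cycle `C_p` on the vertices
`0, …, p-1`, the path `v₁ = 0, v₂ = p, …, v_k = p+k-2` of length `k-1`
(for `k = 1` the path is the single vertex `v₁ = 0`), and the cycle `C_q` on the
vertices `v_k, p+k-1, …, p+q+k-3`. -/
def inftyGraph (p k q : ℕ) : SimpleGraph (Fin (p + q + k - 2)) :=
  SimpleGraph.fromRel (fun a b =>
    ((a : ℕ) + 1 = (b : ℕ) ∧ (b : ℕ) < p) ∨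
    ((a : ℕ) = 0 ∧ (b : ℕ) = p - 1) ∨
    (2 ≤ k ∧ (a : ℕ) = 0 ∧ (b : ℕ) = p) ∨
    (p ≤ (a : ℕ) ∧ (a : ℕ) + 1 = (b : ℕ) ∧ (b : ℕ) ≤ p + k - 2) ∨
    ((a : ℕ) = (if k = 1 then 0 else p + k - 2) ∧ (b : ℕ) = p + k - 1) ∨
    ((a : ℕ) = (if k = 1 then 0 else p + k - 2) ∧ (b : ℕ) = p + q + k - 3) ∨
    (p + k - 1 ≤ (a : ℕ) ∧ (a : ℕ) + 1 = (b : ℕ) ∧ (b : ℕ) ≤ p + q + k - 3))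

/-- The determinant of the distance matrix of `G` with `x` added to every entry. -/
noncomputable def shiftedDet {V : Type*} [Fintype V] [DecidableEq V] (G : SimpleGraph V)
    (x : ℚ) : ℚ :=
  (of fun i j => distMatrix G i j + x).det

theorem shiftedDet_zero {V : Type*} [Fintype V] [DecidableEq V] (G : SimpleGraph V) :
    shiftedDet G 0 = (distMatrix G).det := by
  unfold shiftedDet
  congr 1
  ext i j
  simp

namespace SimpleGraph

/-- A function that changes by at most one along edges, vanishes at `v` and has a descending
neighbor at every other vertex is the distance from `v`. -/
theorem reachable_and_dist_eq {V : Type*} {G : SimpleGraph V} {v : V} {f : V → ℕ}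
    (h₀ : f v = 0) (hlip : ∀ a b, G.Adj a b → f b ≤ f a + 1)
    (hdesc : ∀ a, a ≠ v → ∃ b, G.Adj a b ∧ f b + 1 = f a) (a : V) :
    G.Reachable v a ∧ G.dist v a = f a := by
  have upper : ∀ n a, f a = n → ∃ w : G.Walk v a, w.length = n := by
    intro n
    induction n with
    | zero =>
      intro a ha
      by_cases hav : a = v
      · subst hav
        exact ⟨.nil, rfl⟩
      · obtain ⟨b, -, hb⟩ := hdesc a hav
        omega
    | succ n ih =>
      intro a ha
      have hav : a ≠ v := by
        rintro rfl
        omega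
      obtain ⟨b, hab, hb⟩ := hdesc a hav
      obtain ⟨w, hw⟩ := ih b (by omega)
      exact ⟨w.concat hab.symm, by simp [hw]⟩
  have lower : ∀ a b (w : G.Walk a b), f b ≤ f a + w.length := by
    intro a b w
    induction w with
    | nil => simp
    | cons h w ih =>
      have := hlip _ _ h
      simp only [Walk.length_cons]
      omega
  obtain ⟨w, hw⟩ := upper _ a rfl
  obtain ⟨w', hw'⟩ := w.reachable.exists_walk_length_eq_dist
  refine ⟨w.reachable, le_antisymm (hw ▸ dist_le w) ?_⟩
  have := lower _ _ w'
  omega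

theorem Adj.dist_le_succ {V : Type*} {G : SimpleGraph V} (hG : G.Connected) {a b : V}
    (h : G.Adj a b) (v : V) : G.dist v b ≤ G.dist v a + 1 :=
  (hG.dist_triangle (v := a)).trans (by rw [dist_eq_one_iff_adj.2 h])

theorem Connected.exists_adj_dist_add_one {V : Type*} {G : SimpleGraph V} (hG : G.Connected)
    {v a : V} (h : a ≠ v) : ∃ b, G.Adj a b ∧ G.dist v b + 1 = G.dist v a := by
  obtain ⟨w, hw⟩ := hG.exists_walk_length_eq_dist a v
  cases w with
  | nil => exact absurd rfl h
  | @cons _ b _ hab w =>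
    refine ⟨b, hab, ?_⟩
    have h₁ := dist_le w
    have h₂ := hab.symm.dist_le_succ hG v
    rw [Walk.length_cons, dist_comm] at hw
    rw [dist_comm] at h₁
    omega

theorem Iso.dist_eq {V W : Type*} {G : SimpleGraph V} {H : SimpleGraph W} (e : G ≃g H)
    (hG : G.Connected) (a b : V) : H.dist (e a) (e b) = G.dist a b := by
  have := (reachable_and_dist_eq (G := H) (v := e a) (f := fun c => G.dist a (e.symm c))
    (by simp) (fun c d h => (e.symm.map_adj_iff.2 h).dist_le_succ hG a)
    (fun c hc => by
      obtain ⟨b, hb, hd⟩ := hG.exists_adj_dist_add_one (v := a) (a := e.symm c)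
        (fun h => hc (by rw [← h]; simp))
      exact ⟨e b, by rw [← e.symm.map_adj_iff]; simpa using hb, by simpa using hd⟩) (e b)).2
  simpa using this

theorem Iso.shiftedDet_eq {V W : Type*} [Fintype V] [DecidableEq V] [Fintype W] [DecidableEq W]
    {G : SimpleGraph V} {H : SimpleGraph W} (e : G ≃g H) (hG : G.Connected) (x : ℚ) :
    shiftedDet G x = shiftedDet H x := by
  unfold shiftedDet
  rw [← det_submatrix_equiv_self e.toEquiv]
  congr 1
  ext i j
  simpa [distMatrix] using (e.dist_eq hG i j).symm

/-- The graph obtained from the disjoint union of `G` and `H` by identifying the vertex `u` of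
`G` with the vertex `0` of `H`. -/
def glue {A : Type*} {r : ℕ} (G : SimpleGraph A) (u : A) (H : SimpleGraph (Fin (r + 1))) :
    SimpleGraph (A ⊕ Fin r) where
  Adj
    | .inl a, .inl a' => G.Adj a a'
    | .inl a, .inr b => a = u ∧ H.Adj 0 b.succ
    | .inr b, .inl a => a = u ∧ H.Adj 0 b.succ
    | .inr b, .inr b' => H.Adj b.succ b'.succ
  symm := ⟨by
    rintro (a | b) (a' | b') h
    · exact Adj.symm (G := G) h
    · exact h
    · exact h
    · exact Adj.symm (G := H) h⟩
  loopless := ⟨by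
    rintro (a | b) h
    · exact G.loopless.irrefl a h
    · exact H.loopless.irrefl _ h⟩

section Glue

variable {A : Type*} {r : ℕ} {G : SimpleGraph A} {u : A} {H : SimpleGraph (Fin (r + 1))}

@[simp] theorem glue_adj_inl_inl {a a' : A} :
    (glue G u H).Adj (.inl a) (.inl a') ↔ G.Adj a a' := Iff.rfl

@[simp] theorem glue_adj_inl_inr {a : A} {b : Fin r} :
    (glue G u H).Adj (.inl a) (.inr b) ↔ a = u ∧ H.Adj 0 b.succ := Iff.rfl

@[simp] theorem glue_adj_inr_inl {a : A} {b : Fin r} :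
    (glue G u H).Adj (.inr b) (.inl a) ↔ a = u ∧ H.Adj 0 b.succ := Iff.rfl

@[simp] theorem glue_adj_inr_inr {b b' : Fin r} :
    (glue G u H).Adj (.inr b) (.inr b') ↔ H.Adj b.succ b'.succ := Iff.rfl

theorem glue_reachable_and_dist_inl (hG : G.Connected) (hH : H.Connected) (a : A)
    (c : A ⊕ Fin r) :
    (glue G u H).Reachable (.inl a) c ∧ (glue G u H).dist (.inl a) c =
      c.elim (fun a' => G.dist a a') (fun b => G.dist a u + H.dist 0 b.succ) := by
  refine reachable_and_dist_eq (by simp) ?_ ?_ c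
  · rintro (a₁ | b₁) (a₂ | b₂) h
    · exact Adj.dist_le_succ hG h a
    · obtain ⟨rfl, h⟩ := h
      have := h.dist_le_succ hH 0
      simp only [dist_self] at this
      simp only [Sum.elim_inl, Sum.elim_inr]
      omega
    · obtain ⟨rfl, h⟩ := h
      simp only [Sum.elim_inl, Sum.elim_inr]
      omega
    · have := Adj.dist_le_succ hH h 0
      simp only [Sum.elim_inr]
      omega
  · rintro (a₁ | b₁) h
    · obtain ⟨b, hb, hd⟩ := hG.exists_adj_dist_add_one (v := a) (a := a₁) (by simpa using h)
      exact ⟨.inl b, hb, hd⟩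
    · obtain ⟨b, hb, hd⟩ := hH.exists_adj_dist_add_one (Fin.succ_ne_zero b₁)
      induction b using Fin.cases with
      | zero =>
        refine ⟨.inl u, ⟨rfl, hb.symm⟩, ?_⟩
        simp only [dist_self] at hd
        simp only [Sum.elim_inl, Sum.elim_inr]
        omega
      | succ b =>
        refine ⟨.inr b, hb, ?_⟩
        simp only [Sum.elim_inr]
        omega

theorem glue_dist_inr (hG : G.Connected) (hH : H.Connected) (b : Fin r) (c : A ⊕ Fin r) :
    (glue G u H).dist (.inr b) c =
      c.elim (fun a => H.dist b.succ 0 + G.dist u a) (fun b' => H.dist b.succ b'.succ) := by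
  refine (reachable_and_dist_eq (by simp) ?_ ?_ c).2
  · rintro (a₁ | b₁) (a₂ | b₂) h
    · have := Adj.dist_le_succ hG h u
      simp only [Sum.elim_inl]
      omega
    · obtain ⟨rfl, h⟩ := h
      have := h.dist_le_succ hH b.succ
      simpa using this
    · obtain ⟨rfl, h⟩ := h
      have := h.symm.dist_le_succ hH b.succ
      simpa using this
    · exact Adj.dist_le_succ hH h b.succ
  · have key : ∀ c : Fin (r + 1), c ≠ b.succ → (∀ b', H.Adj c b' →
        H.dist b.succ b' + 1 = H.dist b.succ c → ∃ y, (glue G u H).Adj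
          (Fin.cases (motive := fun _ => A ⊕ Fin r) (.inl u) (fun i => .inr i) c) y ∧
          y.elim (fun a => H.dist b.succ 0 + G.dist u a) (fun b' => H.dist b.succ b'.succ) + 1
            = H.dist b.succ c) := by
      intro c hc b' hb hd
      induction c using Fin.cases with
      | zero =>
        induction b' using Fin.cases with
        | zero => exact absurd hb (H.loopless.irrefl _)
        | succ b' => exact ⟨.inr b', ⟨rfl, hb⟩, hd⟩
      | succ c =>
        induction b' using Fin.cases with
        | zero => exact ⟨.inl u, ⟨rfl, hb.symm⟩, by simpa using hd⟩
        | succ b' => exact ⟨.inr b', hb, hd⟩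
    rintro (a₁ | b₁) h
    · by_cases ha : a₁ = u
      · subst ha
        obtain ⟨b', hb, hd⟩ := hH.exists_adj_dist_add_one (Fin.succ_ne_zero b).symm
        simpa using key 0 (Fin.succ_ne_zero b).symm b' hb hd
      · obtain ⟨b', hb, hd⟩ := hG.exists_adj_dist_add_one ha
        exact ⟨.inl b', hb, by simp only [Sum.elim_inl]; omega⟩
    · have hne : b₁.succ ≠ b.succ := by simpa using h
      obtain ⟨b', hb, hd⟩ := hH.exists_adj_dist_add_one hne
      simpa using key b₁.succ hne b' hb hd

theorem glue_connected (hG : G.Connected) (hH : H.Connected) : (glue G u H).Connected :=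
  connected_iff_exists_forall_reachable _ |>.2
    ⟨.inl u, fun c => (glue_reachable_and_dist_inl hG hH u c).1⟩

end Glue

end SimpleGraph

/-- The matrix obtained by gluing: `D` is bordered with the weights `w` and the block `E`. -/
def borderedMatrix {A B : Type*} (D : Matrix A A ℚ) (w : B → ℚ) (E : Matrix B B ℚ) (x : ℚ) :
    Matrix (A ⊕ B) (A ⊕ B) ℚ :=
  fromBlocks (of fun i j => D i j + x) (of fun _ b => w b) (of fun b _ => w b)
    (of fun b b' => E b b' - w b - w b')

section Bordered

variable {A B : Type*} [Fintype A] [DecidableEq A] [Fintype B] [DecidableEq B]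

theorem det_glued_eq_det_borderedMatrix {D : Matrix A A ℚ} {u : A} (hD : D u u = 0)
    (w : B → ℚ) (E : Matrix B B ℚ) (x : ℚ) :
    (fromBlocks (of fun i j => D i j + x) (of fun a b => D a u + w b + x)
      (of fun b a => w b + D u a + x) (of fun b b' => E b b' + x)).det =
      (borderedMatrix D w E x).det := by
  set R : Matrix B A ℚ := of fun _ a => if a = u then 1 else 0 with hR
  have : fromBlocks (of fun i j => D i j + x) (of fun a b => D a u + w b + x)
      (of fun b a => w b + D u a + x) (of fun b b' => E b b' + x) =
      fromBlocks 1 0 R 1 * borderedMatrix D w E x * fromBlocks 1 Rᵀ 0 1 := by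
    rw [borderedMatrix, fromBlocks_multiply, fromBlocks_multiply]
    congr 1 <;> ext i j <;> simp [hR, mul_apply, hD] <;> ring
  rw [this, det_mul, det_mul, det_fromBlocks_zero₁₂, det_fromBlocks_zero₂₁]
  simp

theorem det_borderedMatrix_add (w : B → ℚ) (E : Matrix B B ℚ) :
    (borderedMatrix (0 : Matrix Unit Unit ℚ) w E 1).det =
      (borderedMatrix (0 : Matrix Unit Unit ℚ) w E 0).det +
        (of fun b b' => E b b' - w b - w b').det := by
  have h₁ : borderedMatrix (0 : Matrix Unit Unit ℚ) w E 1 =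
      (borderedMatrix (0 : Matrix Unit Unit ℚ) w E 0).updateRow (.inl ())
        (borderedMatrix (0 : Matrix Unit Unit ℚ) w E 0 (.inl ()) + Pi.single (.inl ()) 1) := by
    ext (i | i) (j | j) <;> simp [borderedMatrix, updateRow_apply]
  have h₂ : (borderedMatrix (0 : Matrix Unit Unit ℚ) w E 0).updateRow (.inl ())
      (Pi.single (.inl ()) 1) =
      fromBlocks 1 0 (of fun b _ => w b) (of fun b b' => E b b' - w b - w b') := by
    ext (i | i) (j | j) <;> simp [borderedMatrix, updateRow_apply]
  rw [h₁, det_updateRow_add, updateRow_eq_self, h₂, det_fromBlocks_zero₁₂, det_one, one_mul]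

theorem det_borderedMatrix_of_invertible (D : Matrix A A ℚ) (w : B → ℚ) (E : Matrix B B ℚ)
    [Invertible (of fun b b' => E b b' - w b - w b')] (x : ℚ) :
    (borderedMatrix D w E x).det = (of fun b b' => E b b' - w b - w b').det *
      (of fun i j => D i j +
        (x - w ⬝ᵥ (⅟(of fun b b' => E b b' - w b - w b')) *ᵥ w)).det := by
  rw [borderedMatrix, det_fromBlocks₂₂]
  congr 2
  ext i j
  simp only [Matrix.sub_apply, of_apply, mul_apply, dotProduct, mulVec]
  rw [add_sub_assoc]
  congr 2
  simp only [Finset.sum_mul, Finset.mul_sum]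
  rw [Finset.sum_comm]
  refine Finset.sum_congr rfl fun _ _ => Finset.sum_congr rfl fun _ _ => by ring

/-- Bordering a matrix acts on the shifted determinant by an affine substitution, which can be
read off from the case of a single vertex. -/
theorem det_borderedMatrix {D : Matrix A A ℚ} {w : B → ℚ} {E : Matrix B B ℚ} {α β : ℚ}
    (hα : α ≠ 0) (h : ∀ x, (borderedMatrix (0 : Matrix Unit Unit ℚ) w E x).det = α * x + β)
    (x : ℚ) :
    (borderedMatrix D w E x).det = α * (of fun i j => D i j + (x + β / α)).det := by
  have hdet : (of fun b b' => E b b' - w b - w b').det = α := by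
    have := det_borderedMatrix_add w E
    rw [h, h] at this
    linarith
  let := invertibleOfIsUnitDet (of fun b b' => E b b' - w b - w b')
    (by rw [hdet]; exact hα.isUnit)
  have h₀ := det_borderedMatrix_of_invertible (0 : Matrix Unit Unit ℚ) w E 0
  rw [h, hdet] at h₀
  simp only [det_unique, of_apply, Matrix.zero_apply] at h₀
  rw [det_borderedMatrix_of_invertible, hdet]
  have : β / α = - (w ⬝ᵥ (⅟(of fun b b' => E b b' - w b - w b')) *ᵥ w) := by
    field_simp
    linarith
  rw [this, sub_eq_add_neg]

theorem det_borderedMatrix_eq_zero {D : Matrix A A ℚ} {w : B → ℚ} {E : Matrix B B ℚ}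
    {y : B → ℚ} (hy : y ≠ 0) (hw : w ⬝ᵥ y = 0)
    (hE : ∀ b, ∑ b', E b b' * y b' = w b * ∑ b', y b') (x : ℚ) :
    (borderedMatrix D w E x).det = 0 := by
  rw [← exists_mulVec_eq_zero_iff]
  refine ⟨Sum.elim 0 y, fun h => hy (funext fun b => congrFun h (.inr b)), ?_⟩
  ext (a | b)
  · simpa [borderedMatrix, fromBlocks_mulVec, mulVec, dotProduct] using hw
  · have : ∑ b', w b' * y b' = 0 := hw
    simp [borderedMatrix, mulVec, dotProduct, sub_mul,
      Finset.sum_sub_distrib, hE, this, Finset.mul_sum]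

end Bordered

section GlueDet

variable {A : Type*} [Fintype A] [DecidableEq A] {r : ℕ} {G : SimpleGraph A} {u : A}
  {H : SimpleGraph (Fin (r + 1))}

theorem shiftedDet_glue_eq_det_borderedMatrix (hG : G.Connected) (hH : H.Connected) (x : ℚ) :
    shiftedDet (glue G u H) x = (borderedMatrix (distMatrix G)
      (fun b : Fin r => distMatrix H 0 b.succ)
      ((distMatrix H).submatrix Fin.succ Fin.succ) x).det := by
  rw [← det_glued_eq_det_borderedMatrix (u := u) (by simp [distMatrix]), shiftedDet]
  congr 1
  ext (i | i) (j | j)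
  · simp [distMatrix, (glue_reachable_and_dist_inl hG hH _ _).2]
  · simp [distMatrix, (glue_reachable_and_dist_inl hG hH _ _).2]
  · simp [distMatrix, glue_dist_inr hG hH, dist_comm (u := (0 : Fin (r + 1)))]
  · simp [distMatrix, glue_dist_inr hG hH]

theorem shiftedDet_eq_det_borderedMatrix (x : ℚ) :
    shiftedDet H x = (borderedMatrix (0 : Matrix Unit Unit ℚ)
      (fun b : Fin r => distMatrix H 0 b.succ)
      ((distMatrix H).submatrix Fin.succ Fin.succ) x).det := by
  rw [← det_glued_eq_det_borderedMatrix (u := ()) (by simp), shiftedDet]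
  let e : Unit ⊕ Fin r → Fin (r + 1) := Sum.elim (fun _ => 0) Fin.succ
  have he : Function.Bijective e := by
    constructor
    · rintro (i | i) (j | j) h
      · rfl
      · exact absurd h.symm (Fin.succ_ne_zero _)
      · exact absurd h (Fin.succ_ne_zero _)
      · exact congrArg _ (Fin.succ_injective _ h)
    · intro i
      induction i using Fin.cases with
      | zero => exact ⟨.inl (), rfl⟩
      | succ i => exact ⟨.inr i, rfl⟩
  rw [← det_submatrix_equiv_self (Equiv.ofBijective e he)]
  congr 1
  ext (i | i) (j | j) <;> simp [e, distMatrix, dist_comm (u := (0 : Fin (r + 1)))]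

theorem shiftedDet_glue (hG : G.Connected) (hH : H.Connected) {α β : ℚ} (hα : α ≠ 0)
    (h : ∀ x, shiftedDet H x = α * x + β) (x : ℚ) :
    shiftedDet (glue G u H) x = α * shiftedDet G (x + β / α) := by
  rw [shiftedDet_glue_eq_det_borderedMatrix hG hH,
    det_borderedMatrix hα fun x => by rw [← shiftedDet_eq_det_borderedMatrix, h], shiftedDet]

theorem shiftedDet_glue_eq_zero (hG : G.Connected) (hH : H.Connected) {z : Fin (r + 1) → ℚ}
    (hz : z ≠ 0) (hsum : ∑ i, z i = 0) (hker : distMatrix H *ᵥ z = 0) (x : ℚ) :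
    shiftedDet (glue G u H) x = 0 := by
  rw [shiftedDet_glue_eq_det_borderedMatrix hG hH]
  rw [Fin.sum_univ_succ] at hsum
  have hrow : ∀ i, distMatrix H i 0 * z 0 + ∑ j : Fin r, distMatrix H i j.succ * z j.succ = 0 := by
    intro i
    rw [← Fin.sum_univ_succ (f := fun j => distMatrix H i j * z j)]
    exact congrFun hker i
  refine det_borderedMatrix_eq_zero (y := fun b => z b.succ) ?_ ?_ ?_ x
  · intro h
    have hs : ∀ b : Fin r, z b.succ = 0 := fun b => congrFun h b
    refine hz (funext fun i => ?_)
    induction i using Fin.cases with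
    | zero => simpa [hs] using hsum
    | succ i => exact hs i
  · simpa [distMatrix, dotProduct] using hrow 0
  · intro b
    have h₁ := hrow b.succ
    have h₂ : ∑ b' : Fin r, z b'.succ = - z 0 := by linarith
    have h₃ : distMatrix H 0 b.succ = distMatrix H b.succ 0 := by
      simp [distMatrix, dist_comm]
    simp only [submatrix_apply, h₂, h₃]
    linarith

end GlueDet

theorem shiftedDet_top_fin_two (x : ℚ) :
    shiftedDet (⊤ : SimpleGraph (Fin 2)) x = -2 * x + -1 := by
  rw [shiftedDet, det_fin_two]
  simp [distMatrix, dist_top]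
  ring

theorem shiftedDet_glue_top {A : Type*} [Fintype A] [DecidableEq A] {G : SimpleGraph A}
    (hG : G.Connected) (u : A) (x : ℚ) :
    shiftedDet (glue G u (⊤ : SimpleGraph (Fin 2))) x = -2 * shiftedDet G (x + 1 / 2) := by
  rw [shiftedDet_glue hG connected_top (by norm_num) shiftedDet_top_fin_two]
  norm_num

/-- The cycle on `0, …, q - 1`, each vertex being joined to its successor. -/
def cycleOn (q : ℕ) : SimpleGraph (Fin q) :=
  SimpleGraph.fromRel fun a b =>
    (a : ℕ) + 1 = (b : ℕ) ∨ ((a : ℕ) = 0 ∧ (b : ℕ) = q - 1)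

/-- The distance between the positions `i` and `j` on a cycle of length `q`. -/
def cycleDist (q i j : ℕ) : ℕ := min ((i - j) + (j - i)) (q - ((i - j) + (j - i)))

theorem cycleOn_reachable_and_dist {q : ℕ} (i j : Fin q) :
    (cycleOn q).Reachable i j ∧ (cycleOn q).dist i j = cycleDist q i j := by
  refine reachable_and_dist_eq (f := fun j : Fin q => cycleDist q i j) ?_ ?_ ?_ j
  · simp [cycleDist]
  · intro a b h
    simp only [cycleOn, fromRel_adj, ne_eq, Fin.ext_iff] at h
    simp only [cycleDist]
    omega
  · intro a ha
    simp only [ne_eq, Fin.ext_iff] at ha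
    have hi := i.2
    have ha' := a.2
    by_cases h : ((i : ℕ) < a ∧ (a : ℕ) - i ≤ q - ((a : ℕ) - i)) ∨
        ((a : ℕ) < i ∧ q - ((i : ℕ) - a) < (i : ℕ) - a)
    · by_cases h₀ : (a : ℕ) = 0
      · refine ⟨⟨q - 1, by omega⟩, ?_, ?_⟩ <;>
          simp only [cycleOn, fromRel_adj, ne_eq, Fin.ext_iff, cycleDist] <;> grind
      · refine ⟨⟨a - 1, by omega⟩, ?_, ?_⟩ <;>
          simp only [cycleOn, fromRel_adj, ne_eq, Fin.ext_iff, cycleDist] <;> grind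
    · by_cases h₀ : (a : ℕ) = q - 1
      · refine ⟨⟨0, by omega⟩, ?_, ?_⟩ <;>
          simp only [cycleOn, fromRel_adj, ne_eq, Fin.ext_iff, cycleDist] <;> grind
      · refine ⟨⟨a + 1, by omega⟩, ?_, ?_⟩ <;>
          simp only [cycleOn, fromRel_adj, ne_eq, Fin.ext_iff, cycleDist] <;> grind

theorem cycleOn_connected (r : ℕ) : (cycleOn (r + 1)).Connected :=
  connected_iff_exists_forall_reachable _ |>.2
    ⟨0, fun j => (cycleOn_reachable_and_dist 0 j).1⟩

theorem val_finRotate {r : ℕ} (i : Fin (r + 1)) :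
    (finRotate (r + 1) i : ℕ) = if (i : ℕ) = r then 0 else (i : ℕ) + 1 := by
  simpa only [Fin.ext_iff, Fin.val_last] using coe_finRotate i

theorem det_one_add_rotate {r : ℕ} (hr : Even r) :
    (1 + (1 : Matrix (Fin (r + 1)) (Fin (r + 1)) ℚ).submatrix (finRotate (r + 1)) id).det = 2 := by
  have hσ := val_finRotate (r := r)
  have hsign : Equiv.Perm.sign (finRotate (r + 1)) = 1 := by
    rw [sign_finRotate, Nat.add_sub_cancel, hr.neg_one_pow]
  generalize finRotate (r + 1) = σ at *
  have hlast : σ (Fin.last r) = 0 := by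
    ext
    simp [hσ]
  have hne : ∀ i, i ≠ Fin.last r → (σ i : ℕ) = i + 1 := by
    intro i hi
    rw [hσ, if_neg (by simpa [Fin.ext_iff] using hi)]
  set T := 1 + (1 : Matrix (Fin (r + 1)) (Fin (r + 1)) ℚ).submatrix σ id with hT
  have hrow : T.updateRow (Fin.last r) (Pi.single (Fin.last r) 1 + Pi.single 0 1) = T := by
    refine (congrArg _ ?_).trans (updateRow_eq_self T (Fin.last r))
    ext j
    simp [hT, one_apply, Pi.single_apply, eq_comm, hlast]
  have h₁ : (T.updateRow (Fin.last r) (Pi.single (Fin.last r) 1)).det = 1 := by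
    rw [det_of_isUpperTriangular]
    · refine Finset.prod_eq_one fun i _ => ?_
      by_cases hi : i = Fin.last r
      · simp [hi]
      · have : σ i ≠ i := by
          rw [ne_eq, Fin.ext_iff, hne i hi]
          omega
        simp [hT, updateRow_apply, hi, one_apply, this]
    · intro i j hij
      have hij : j < i := hij
      by_cases hi : i = Fin.last r
      · simp [hi, (hi ▸ hij).ne]
      · have : σ i ≠ j := by
          rw [ne_eq, Fin.ext_iff, hne i hi]
          have : (j : ℕ) < i := hij
          omega
        simp [hT, updateRow_apply, hi, one_apply, this, hij.ne']
  have h₂ : (T.updateRow (Fin.last r) (Pi.single 0 1)).det = 1 := by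
    have h := det_permute σ.symm (T.updateRow (Fin.last r) (Pi.single 0 1))
    rw [Equiv.Perm.sign_symm, hsign, Units.val_one, Int.cast_one, one_mul] at h
    rw [← h, det_of_isLowerTriangular]
    · refine Finset.prod_eq_one fun i _ => ?_
      obtain ⟨i, rfl⟩ := σ.surjective i
      by_cases hi : i = Fin.last r
      · subst hi
        rw [submatrix_apply, Equiv.symm_apply_apply]
        simp [hlast]
      · have : i ≠ σ i := by
          rw [ne_eq, Fin.ext_iff, hne i hi]
          omega
        simp [hT, updateRow_apply, hi, one_apply, this]
    · intro i j hij
      obtain ⟨i, rfl⟩ := σ.surjective i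
      have hij : σ i < j := hij
      by_cases hi : i = Fin.last r
      · subst hi
        rw [hlast] at hij
        rw [submatrix_apply, Equiv.symm_apply_apply]
        simp [hij.ne']
      · have : i ≠ j := by
          rw [Fin.lt_def, hne i hi] at hij
          rw [ne_eq, Fin.ext_iff]
          omega
        simp [hT, updateRow_apply, hi, one_apply, this, hij.ne]
  rw [← hrow, det_updateRow_add, h₁, h₂]
  norm_num

theorem cycleDist_rotate_sum {m s t s' t' : ℕ} (hs : s < 2 * m + 1) (ht : t < 2 * m + 1)
    (hs' : s' = if s = 2 * m then 0 else s + 1) (ht' : t' = if t = 2 * m then 0 else t + 1)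
    {f : ℕ → ℕ} (hf : ∀ i, f i = if i % 2 = 0 then i / 2 else (2 * m + 1 + i) / 2) :
    cycleDist (2 * m + 1) (f s) (f t) + cycleDist (2 * m + 1) (f s) (f t') +
      cycleDist (2 * m + 1) (f s') (f t) + cycleDist (2 * m + 1) (f s') (f t') +
        (if s = t then 1 else 0) = 2 * m + 1 := by
  have key : ∀ i j, i < 2 * m + 1 → j < 2 * m + 1 → cycleDist (2 * m + 1) (f i) (f j) =
      if ((i - j) + (j - i)) % 2 = 0 then ((i - j) + (j - i)) / 2
      else (2 * m + 1 - ((i - j) + (j - i))) / 2 := by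
    intro i j hi hj
    rw [hf, hf, cycleDist]
    split_ifs <;> omega
  have hs'' : s' < 2 * m + 1 := by split_ifs at hs' <;> omega
  have ht'' : t' < 2 * m + 1 := by split_ifs at ht' <;> omega
  rw [key _ _ hs ht, key _ _ hs ht'', key _ _ hs'' ht, key _ _ hs'' ht'']
  split_ifs at hs' ht' <;> subst hs' ht' <;> grind

/-- The permutation listing the vertices of a cycle of odd length `2 * m + 1` in steps of
`m + 1`. -/
def halfStep (m : ℕ) : Fin (2 * m + 1) ≃ Fin (2 * m + 1) where
  toFun i := ⟨if (i : ℕ) % 2 = 0 then i / 2 else (2 * m + 1 + i) / 2, by split_ifs <;> omega⟩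
  invFun i := ⟨if (i : ℕ) ≤ m then 2 * i else 2 * i - (2 * m + 1), by split_ifs <;> omega⟩
  left_inv i := by
    ext
    simp only
    split_ifs <;> omega
  right_inv i := by
    ext
    simp only
    split_ifs <;> omega

theorem shiftedDet_cycleOn_odd (m : ℕ) (x : ℚ) :
    shiftedDet (cycleOn (2 * m + 1)) x = (2 * m + 1) * x + m * (m + 1) := by
  set q : ℚ := 2 * m + 1 with hq
  set M : Matrix (Fin (2 * m + 1)) (Fin (2 * m + 1)) ℚ :=
    (of fun i j => distMatrix (cycleOn (2 * m + 1)) i j + x).submatrix (halfStep m) (halfStep m)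
    with hM
  set T := 1 + (1 : Matrix (Fin (2 * m + 1)) (Fin (2 * m + 1)) ℚ).submatrix
    (finRotate (2 * m + 1)) id with hT
  have hdetM : M.det = shiftedDet (cycleOn (2 * m + 1)) x := det_submatrix_equiv_self _ _
  have hdetT : T.det = 2 := det_one_add_rotate ⟨m, two_mul m⟩
  have hTMT : T * M * Tᵀ = -(1 + replicateCol Unit (fun _ => -(q + 4 * x)) *
      replicateRow Unit (fun _ => (1 : ℚ))) := by
    have hσ := val_finRotate (r := 2 * m)
    generalize finRotate (2 * m + 1) = σ at *
    ext s t
    have hsum := congrArg (Nat.cast (R := ℚ)) <| cycleDist_rotate_sum s.2 t.2 (hσ s) (hσ t)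
      (f := fun i => if i % 2 = 0 then i / 2 else (2 * m + 1 + i) / 2) (fun _ => rfl)
    push_cast at hsum
    have hentry : ∀ i j, M i j = cycleDist (2 * m + 1) (halfStep m i) (halfStep m j) + x := by
      intro i j
      simp [hM, distMatrix, (cycleOn_reachable_and_dist _ _).2]
    have : (T * M * Tᵀ) s t = M s t + M s (σ t) + M (σ s) t + M (σ s) (σ t) := by
      simp [hT, mul_apply, one_apply, add_mul, mul_add, Finset.sum_add_distrib]
      ring
    rw [this, hentry, hentry, hentry, hentry]
    simp only [halfStep, Equiv.coe_fn_mk, Matrix.neg_apply, Matrix.add_apply, one_apply,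
      mul_apply, replicateCol_apply, replicateRow_apply, Finset.univ_unique, Finset.sum_const,
      Finset.card_singleton, Fin.ext_iff, one_smul]
    linarith
  have hdet := congrArg det hTMT
  rw [det_mul, det_mul, det_transpose, hdetT, hdetM, det_neg,
    det_one_add_replicateCol_mul_replicateRow, Fintype.card_fin,
    Odd.neg_one_pow ⟨m, rfl⟩] at hdet
  simp only [dotProduct, one_mul, Finset.sum_const, Finset.card_univ, Fintype.card_fin,
    nsmul_eq_mul] at hdet
  push_cast at hdet
  rw [hq] at hdet ⊢
  linarith

/-- Four vertices of an even cycle supporting a vector in the kernel of its distance matrix. -/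
theorem exists_distMatrix_cycleOn_mulVec_eq_zero {r : ℕ} (hr : 3 ≤ r + 1) (he : Even (r + 1)) :
    ∃ z : Fin (r + 1) → ℚ, z ≠ 0 ∧ ∑ i, z i = 0 ∧ distMatrix (cycleOn (r + 1)) *ᵥ z = 0 := by
  obtain ⟨m, hm⟩ := he
  let a : Fin (r + 1) := ⟨0, by omega⟩
  let b : Fin (r + 1) := ⟨1, by omega⟩
  let c : Fin (r + 1) := ⟨m, by omega⟩
  let d : Fin (r + 1) := ⟨m + 1, by omega⟩
  refine ⟨Pi.single a 1 - Pi.single b 1 + Pi.single c 1 - Pi.single d 1, fun h => ?_, ?_, ?_⟩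
  · have := congrFun h a
    have hb : a ≠ b := by simp [a, b]
    have hc : a ≠ c := by simp [a, c]; omega
    have hd : a ≠ d := by simp [a, d]
    simp [hb, hc, hd] at this
  · simp [Finset.sum_add_distrib, Finset.sum_sub_distrib]
  · simp only [mulVec_sub, mulVec_add, mulVec_single_one]
    ext i
    have : cycleDist (r + 1) i a + cycleDist (r + 1) i c =
        cycleDist (r + 1) i b + cycleDist (r + 1) i d := by
      simp only [cycleDist, a, b, c, d]
      omega
    have := congrArg (Nat.cast (R := ℚ)) this
    push_cast at this
    simp only [Pi.sub_apply, Pi.add_apply, Pi.zero_apply, col_apply, distMatrix,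
      (cycleOn_reachable_and_dist _ _).2]
    linarith

theorem shiftedDet_cycleOn_even {r : ℕ} (hr : 3 ≤ r + 1) (he : Even (r + 1)) (x : ℚ) :
    shiftedDet (cycleOn (r + 1)) x = 0 := by
  obtain ⟨z, hz, hsum, hker⟩ := exists_distMatrix_cycleOn_mulVec_eq_zero hr he
  rw [shiftedDet, ← exists_mulVec_eq_zero_iff]
  refine ⟨z, hz, funext fun i => ?_⟩
  have := congrFun hker i
  simp only [mulVec, dotProduct, of_apply, add_mul, Finset.sum_add_distrib, ← Finset.mul_sum,
    hsum, mul_zero, add_zero] at this ⊢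
  exact this

/-- A vertex outside a connected subgraph at maximal distance from it is not a cut vertex. -/
theorem exists_notMem_range_connected_induce_compl {V W : Type*} [Finite V] {G : SimpleGraph V}
    {H : SimpleGraph W} (hG : G.Connected) (hH : H.Connected) (f : H ↪g G)
    (hf : ¬ Function.Surjective f) :
    ∃ v ∉ Set.range f, (G.induce {v}ᶜ).Connected := by
  obtain ⟨w⟩ := hH.nonempty
  obtain ⟨v, hv, hmax⟩ := Set.exists_max_image (Set.range f)ᶜ (G.dist (f w)) (Set.toFinite _)
    (by simpa [Set.nonempty_compl, Set.range_eq_univ] using hf)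
  have hne : ∀ a, f a ≠ v := fun a h => hv ⟨a, h⟩
  refine ⟨v, hv, connected_iff_exists_forall_reachable _ |>.2 ⟨⟨f w, hne w⟩, ?_⟩⟩
  have hrange : ∀ a, (G.induce {v}ᶜ).Reachable ⟨f w, hne w⟩ ⟨f a, hne a⟩ := by
    let g : H →g G.induce {v}ᶜ := ⟨fun a => ⟨f a, hne a⟩, fun h => f.map_adj_iff.2 h⟩
    exact fun a => (hH.preconnected w a).map g
  have key : ∀ n (x : V) (hx : x ≠ v), G.dist (f w) x = n →
      (G.induce {v}ᶜ).Reachable ⟨f w, hne w⟩ ⟨x, hx⟩ := by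
    intro n
    induction n with
    | zero =>
      intro x hx h
      obtain rfl := (hG.dist_eq_zero_iff).1 h
      exact .refl _
    | succ n ih =>
      intro x hx h
      by_cases hxr : x ∈ Set.range f
      · obtain ⟨a, rfl⟩ := hxr
        exact hrange a
      · obtain ⟨y, hxy, hy⟩ := hG.exists_adj_dist_add_one (v := f w) (a := x) (by
          rintro rfl
          simp at h)
        have := hmax x hxr
        have hyv : y ≠ v := by
          rintro rfl
          omega
        refine (ih y hyv (by omega)).trans (Adj.reachable ?_)
        exact hxy.symm
  exact fun x => key _ x.1 x.2 rfl

theorem ncard_edgeSet_eq_add_degree {V : Type*} [Fintype V] [DecidableEq V] (G : SimpleGraph V)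
    [DecidableRel G.Adj] (v : V) :
    G.edgeSet.ncard = (G.induce {v}ᶜ).edgeSet.ncard + G.degree v := by
  have h := G.card_edgeFinset_induce_compl_singleton v
  rw [card_edgeFinset_deleteIncidenceSet] at h
  have hle : G.degree v ≤ G.edgeFinset.card := by
    rw [← card_incidenceFinset_eq_degree]
    exact Finset.card_le_card (G.incidenceFinset_subset v)
  rw [← coe_edgeFinset, ← coe_edgeFinset, Set.ncard_coe_finset, Set.ncard_coe_finset]
  omega

/-- A graph with a vertex `v` whose only neighbor is `u` arises by gluing an edge at `u`. -/
noncomputable def glueTopIso {V : Type*} {G : SimpleGraph V} {v : V} {u : ({v}ᶜ : Set V)}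
    (h : ∀ a, G.Adj v a ↔ a = u) :
    glue (G.induce {v}ᶜ) u (⊤ : SimpleGraph (Fin 2)) ≃g G where
  toEquiv := Equiv.ofBijective (Sum.elim Subtype.val fun _ : Fin 1 => v) (by
    constructor
    · rintro (a | i) (b | j) hab
      · exact congrArg _ (Subtype.ext hab)
      · exact absurd hab a.2
      · exact absurd hab.symm b.2
      · exact congrArg _ (Subsingleton.elim _ _)
    · intro x
      by_cases hx : x = v
      · exact ⟨.inr 0, hx.symm⟩
      · exact ⟨.inl ⟨x, hx⟩, rfl⟩)
  map_rel_iff' := by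
    rintro (a | i) (b | j)
    · rfl
    · change G.Adj a v ↔ a = u ∧ (0 : Fin 2) ≠ j.succ
      simp [adj_comm, h, Subtype.ext_iff, (Fin.succ_ne_zero j).symm]
    · change G.Adj v b ↔ b = u ∧ (0 : Fin 2) ≠ i.succ
      simp [h, Subtype.ext_iff, (Fin.succ_ne_zero i).symm]
    · change G.Adj v v ↔ i.succ ≠ j.succ
      simp [Subsingleton.elim i j]

/-- If `G` contains a connected induced subgraph `H`, then `G` has at least `|V(G)| - |V(H)|` more
edges than `H`; in case of equality the rest of `G` consists of trees attached to `H`, and the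
shifted determinant of `G` is determined by that of `H`. -/
theorem shiftedDet_of_embedding {W : Type*} [Fintype W] [DecidableEq W] {H : SimpleGraph W}
    (hH : H.Connected) (n : ℕ) {V : Type*} [Fintype V] [DecidableEq V] {G : SimpleGraph V}
    (hG : G.Connected) (f : H ↪g G) (hcard : Fintype.card V = Fintype.card W + n) :
    H.edgeSet.ncard + n ≤ G.edgeSet.ncard ∧ (G.edgeSet.ncard = H.edgeSet.ncard + n →
      ∀ x, shiftedDet G x = (-2) ^ n * shiftedDet H (x + n / 2)) := by
  classical
  induction n generalizing V with
  | zero =>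
    have hf : Function.Bijective f :=
      (Fintype.bijective_iff_injective_and_card f).2 ⟨f.injective, hcard.symm⟩
    let e : H ≃g G := ⟨Equiv.ofBijective f hf, f.map_adj_iff⟩
    constructor
    · rw [add_zero, ← Nat.card_coe_set_eq, ← Nat.card_coe_set_eq]
      exact (Nat.card_congr e.mapEdgeSet).le
    · intro _ x
      simp [e.shiftedDet_eq hH]
  | succ n ih =>
    obtain ⟨v, hv, hconn⟩ := exists_notMem_range_connected_induce_compl hG hH f (by
      intro hf
      have := Fintype.card_le_of_surjective f hf
      omega)
    let g : H ↪g G.induce {v}ᶜ :=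
      ⟨⟨fun a => ⟨f a, fun h => hv ⟨a, h⟩⟩, fun a b hab => f.injective (congrArg Subtype.val hab)⟩,
        f.map_adj_iff⟩
    have hcard' : Fintype.card ({v}ᶜ : Set V) = Fintype.card W + n := by
      simp only [Fintype.card_compl_set, Set.card_singleton]
      omega
    obtain ⟨hle, heq⟩ := ih hconn g hcard'
    have hedges := ncard_edgeSet_eq_add_degree G v
    have hdeg : 0 < G.degree v := by
      obtain ⟨w⟩ := hH.nonempty
      obtain ⟨b, hb, -⟩ := hG.exists_adj_dist_add_one (v := f w) (a := v) fun h => hv ⟨w, h.symm⟩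
      exact (G.degree_pos_iff_exists_adj v).2 ⟨b, hb⟩
    refine ⟨by omega, fun h x => ?_⟩
    have hone : G.degree v = 1 := by omega
    obtain ⟨u, hu, huniq⟩ := degree_eq_one_iff_existsUnique_adj.1 hone
    let u' : ({v}ᶜ : Set V) := ⟨u, hu.ne'⟩
    have hadj : ∀ a, G.Adj v a ↔ a = u' := fun a => ⟨huniq a, fun ha => ha ▸ hu⟩
    rw [← (glueTopIso hadj).shiftedDet_eq (glue_connected hconn connected_top),
      shiftedDet_glue_top hconn, heq (by omega)]
    push_cast
    ring_nf

/-- The cycle `C_p` on `0, …, p - 1` with a path of length `j` attached at `0`. -/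
def lollipop (p j : ℕ) : SimpleGraph (Fin (p + j)) :=
  SimpleGraph.fromRel fun a b =>
    ((a : ℕ) + 1 = (b : ℕ) ∧ (b : ℕ) < p) ∨ ((a : ℕ) = 0 ∧ (b : ℕ) = p - 1) ∨
    (1 ≤ j ∧ (a : ℕ) = 0 ∧ (b : ℕ) = p) ∨ (p ≤ (a : ℕ) ∧ (a : ℕ) + 1 = (b : ℕ))

/-- The last vertex of the path of a lollipop. -/
def lollipopEnd {p : ℕ} (hp : 3 ≤ p) (j : ℕ) : Fin (p + j) :=
  ⟨if j = 0 then 0 else p + j - 1, by split_ifs <;> omega⟩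

def cycleOnIsoLollipop (p : ℕ) : cycleOn p ≃g lollipop p 0 where
  toEquiv := Equiv.refl _
  map_rel_iff' := by
    intro a b
    have ha := a.2
    have hb := b.2
    simp only [lollipop, cycleOn, fromRel_adj, ne_eq, Fin.ext_iff, Equiv.refl_apply]
    omega

def glueLollipopIso {p : ℕ} (hp : 3 ≤ p) (j : ℕ) :
    glue (lollipop p j) (lollipopEnd hp j) (⊤ : SimpleGraph (Fin 2)) ≃g lollipop p (j + 1) where
  toEquiv := finSumFinEquiv
  map_rel_iff' := by
    rintro (a | a) (b | b) <;> have ha := a.2 <;> have hb := b.2 <;>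
      simp only [lollipop, lollipopEnd, fromRel_adj, ne_eq, Fin.ext_iff, glue_adj_inl_inl,
        glue_adj_inl_inr, glue_adj_inr_inl, glue_adj_inr_inr, finSumFinEquiv_apply_left,
        finSumFinEquiv_apply_right, Fin.val_castAdd, Fin.val_natAdd, top_adj, Fin.val_succ,
        Fin.val_zero] <;>
      grind

def glueCycleOnIso {p : ℕ} (hp : 3 ≤ p) (j r : ℕ) (hr : 2 ≤ r) :
    glue (lollipop p j) (lollipopEnd hp j) (cycleOn (r + 1)) ≃g
      inftyGraph p (j + 1) (r + 1) where
  toEquiv := finSumFinEquiv.trans (finCongr (by omega))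
  map_rel_iff' := by
    have e₁ : p + (j + 1) - 2 = p + j - 1 := by omega
    have e₂ : p + (j + 1) - 1 = p + j := by omega
    have e₃ : p + (r + 1) + (j + 1) - 3 = p + j + (r - 1) := by omega
    rintro (a | a) (b | b) <;> have ha := a.2 <;> have hb := b.2 <;>
      simp only [lollipop, lollipopEnd, inftyGraph, cycleOn, fromRel_adj, ne_eq, Fin.ext_iff,
        glue_adj_inl_inl, glue_adj_inl_inr, glue_adj_inr_inl, glue_adj_inr_inr,
        Equiv.trans_apply, finCongr_apply, Fin.val_cast, finSumFinEquiv_apply_left,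
        finSumFinEquiv_apply_right, Fin.val_castAdd, Fin.val_natAdd, Fin.val_succ,
        Fin.val_zero, e₁, e₂, e₃] <;>
      grind (splits := 40)

theorem lollipop_connected_and_shiftedDet {p : ℕ} (hp : 3 ≤ p) (j : ℕ) :
    (lollipop p j).Connected ∧
      ∀ x, shiftedDet (lollipop p j) x = (-2) ^ j * shiftedDet (cycleOn p) (x + j / 2) := by
  have hc : (cycleOn p).Connected := by
    obtain ⟨r, rfl⟩ := Nat.exists_eq_add_of_lt (show 0 < p by omega)
    rw [Nat.zero_add]
    exact cycleOn_connected r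
  induction j with
  | zero =>
    refine ⟨(cycleOnIsoLollipop p).connected_iff.1 hc, fun x => ?_⟩
    simp [(cycleOnIsoLollipop p).shiftedDet_eq hc]
  | succ j ih =>
    have hg : (glue (lollipop p j) (lollipopEnd hp j) (⊤ : SimpleGraph (Fin 2))).Connected :=
      glue_connected ih.1 connected_top
    refine ⟨(glueLollipopIso hp j).connected_iff.1 hg, fun x => ?_⟩
    rw [← (glueLollipopIso hp j).shiftedDet_eq hg, shiftedDet_glue_top ih.1, ih.2]
    push_cast
    ring_nf

theorem inftyGraph_connected {p : ℕ} (hp : 3 ≤ p) (j r : ℕ) (hr : 2 ≤ r) :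
    (inftyGraph p (j + 1) (r + 1)).Connected :=
  (glueCycleOnIso hp j r hr).connected_iff.1
    (glue_connected (lollipop_connected_and_shiftedDet hp j).1 (cycleOn_connected r))

theorem shiftedDet_inftyGraph_of_even {p : ℕ} (hp : 3 ≤ p) (j r : ℕ) (hr : 2 ≤ r)
    (h : Even p ∨ Even (r + 1)) (x : ℚ) : shiftedDet (inftyGraph p (j + 1) (r + 1)) x = 0 := by
  obtain ⟨hL, hdet⟩ := lollipop_connected_and_shiftedDet hp j
  rw [← (glueCycleOnIso hp j r hr).shiftedDet_eq (glue_connected hL (cycleOn_connected r))]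
  rcases Nat.even_or_odd (r + 1) with hq | ⟨m, hm⟩
  · obtain ⟨z, hz, hsum, hker⟩ := exists_distMatrix_cycleOn_mulVec_eq_zero (by omega) hq
    exact shiftedDet_glue_eq_zero hL (cycleOn_connected r) hz hsum hker x
  · obtain rfl : r = 2 * m := by omega
    have hp' : Even p := h.resolve_right (by rw [Nat.not_even_iff_odd]; exact ⟨m, hm⟩)
    obtain ⟨s, rfl⟩ : ∃ s, p = s + 1 := ⟨p - 1, by omega⟩
    rw [shiftedDet_glue hL (cycleOn_connected _) (by positivity) (shiftedDet_cycleOn_odd m), hdet,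
      shiftedDet_cycleOn_even hp hp']
    simp

theorem shiftedDet_inftyGraph_of_odd {l m : ℕ} (hl : 3 ≤ 2 * l + 1) (hm : 2 ≤ 2 * m) (j : ℕ)
    (x : ℚ) :
    shiftedDet (inftyGraph (2 * l + 1) (j + 1) (2 * m + 1)) x = (-2) ^ j *
      ((2 * l + 1) * (2 * m + 1) * (x + j / 2) + (2 * m + 1) * (l * (l + 1)) +
        (2 * l + 1) * (m * (m + 1))) := by
  obtain ⟨hL, hdet⟩ := lollipop_connected_and_shiftedDet hl j
  have hq : (2 * (m : ℚ) + 1) ≠ 0 := by positivity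
  rw [← (glueCycleOnIso hl j _ hm).shiftedDet_eq (glue_connected hL (cycleOn_connected _)),
    shiftedDet_glue hL (cycleOn_connected _) hq (shiftedDet_cycleOn_odd m), hdet,
    shiftedDet_cycleOn_odd]
  field_simp
  ring

/-- The edge of `∞(p,k,q)` from each nonzero vertex to its predecessor, followed by the closing
edges of the two cycles. -/
def inftyEdge (p j q i : ℕ) : ℕ × ℕ :=
  if i + 2 = p + q + j then (0, p - 1)
  else if i + 1 = p + q + j then (if j = 0 then 0 else p + j - 1, p + q + j - 2)
  else (if i + 1 = p then 0 else if i + 1 = p + j ∧ j ≠ 0 then p + j - 1 else i, i + 1)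

theorem add_le_ncard_edgeSet_inftyGraph {p q : ℕ} (hp : 3 ≤ p) (hq : 3 ≤ q) (j : ℕ) :
    p + q + j ≤ (inftyGraph p (j + 1) q).edgeSet.ncard := by
  have hlt : ∀ i < p + q + j, (inftyEdge p j q i).1 < (inftyEdge p j q i).2 ∧
      (inftyEdge p j q i).2 < p + q + (j + 1) - 2 := by
    intro i hi
    unfold inftyEdge
    grind
  let a : Fin (p + q + j) → Fin (p + q + (j + 1) - 2) := fun i =>
    ⟨(inftyEdge p j q i).1, (hlt i i.2).1.trans (hlt i i.2).2⟩
  let b : Fin (p + q + j) → Fin (p + q + (j + 1) - 2) := fun i =>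
    ⟨(inftyEdge p j q i).2, (hlt i i.2).2⟩
  have hinj : Function.Injective fun i => s(a i, b i) := by
    intro i i' h
    have hi := i.2
    have hi' := i'.2
    have h₁ := (hlt i i.2).1
    have h₂ := (hlt i' i'.2).1
    simp only [a, b, Sym2.eq_iff, Fin.ext_iff] at h
    have h : inftyEdge p j q i = inftyEdge p j q i' := by
      rw [Prod.ext_iff]
      omega
    ext
    unfold inftyEdge at h
    grind
  have hmem : (Set.range fun i => s(a i, b i)) ⊆ (inftyGraph p (j + 1) q).edgeSet := by
    rintro _ ⟨i, rfl⟩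
    have hi := i.2
    simp only [mem_edgeSet, inftyGraph, fromRel_adj, ne_eq, Fin.ext_iff, a, b, inftyEdge]
    grind (splits := 40)
  have := Set.ncard_le_ncard hmem
  rwa [← Set.image_univ, Set.ncard_image_of_injective _ hinj, Set.ncard_univ,
    Nat.card_eq_fintype_card, Fintype.card_fin] at this

/-- If `G` is a bicyclic graph on `p+q-1+n` vertices (`p, q ≥ 3`, `k ≥ 1`,
`n ≥ k-1`) containing an induced subgraph isomorphic to `∞(p,k,q)`, then the
determinant of its distance matrix is `0` when `p` or `q` is even, and equals
`((pq-1)(p+q)/4 + (n/2)pq)·(-2)^n` when both `p` and `q` are odd. -/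
theorem det_distMatrix_bicyclic {V : Type*} [Fintype V] [DecidableEq V]
    (p q k n : ℕ) (hp : 3 ≤ p) (hq : 3 ≤ q) (hk : 1 ≤ k) (hn : k - 1 ≤ n)
    (G : SimpleGraph V) (hconn : G.Connected)
    (hcard : Fintype.card V = p + q - 1 + n)
    (hbicyclic : G.edgeSet.ncard = Fintype.card V + 1)
    (hsub : Nonempty (inftyGraph p k q ↪g G)) :
    ((Even p ∨ Even q) → (distMatrix G).det = 0) ∧
    ((Odd p ∧ Odd q) → (distMatrix G).det =
      (((p : ℚ) * q - 1) * ((p : ℚ) + q) / 4 + (n : ℚ) / 2 * ((p : ℚ) * q)) *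
        (-2 : ℚ) ^ n) := by
  obtain ⟨f⟩ := hsub
  obtain ⟨j, rfl⟩ : ∃ j, k = j + 1 := ⟨k - 1, by omega⟩
  obtain ⟨i, rfl⟩ : ∃ i, n = j + i := ⟨n - j, by omega⟩
  obtain ⟨r, rfl⟩ : ∃ r, q = r + 1 := ⟨q - 1, by omega⟩
  obtain ⟨hle, hdet⟩ := shiftedDet_of_embedding (inftyGraph_connected hp j r (by omega)) i hconn f
    (by rw [hcard, Fintype.card_fin]; omega)
  have hedges := add_le_ncard_edgeSet_inftyGraph hp hq j
  specialize hdet (by omega) 0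
  rw [shiftedDet_zero] at hdet
  refine ⟨fun h => ?_, ?_⟩
  · rw [hdet, shiftedDet_inftyGraph_of_even hp j r (by omega) h, mul_zero]
  · rintro ⟨⟨l, rfl⟩, m, hm⟩
    obtain rfl : r = 2 * m := by omega
    rw [hdet, shiftedDet_inftyGraph_of_odd hp (by omega), pow_add]
    push_cast
    ring
end

section
/- Let p, q ≥ 3, k ≥ 1 and n ≥ k−1 be integers, and let G be a bicyclic graph on p+q−1+n vertices that contains an induced subgraph isomorphic to the ∞-graph ∞(p,k,q). Then the determinant of the distance matrix of G equals the determinant of the distance matrix of G(p,q;n). -/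
open SimpleGraph Matrix

/-- The graph `G(p,q;n)` on `Fin (p+q-1+n)`: the graph `∞(p,1,q)` — the cycle `C_p`
on `0, …, p-1` and the cycle `C_q` on `0, p, …, p+q-2`, sharing the center vertex
`0` — together with a pendant path `0, p+q-1, p+q, …, p+q-2+n` on `n` new vertices
planted at the center vertex.  In particular `G(p,q;0) = ∞(p,1,q)`. -/
def Gpq (p q n : ℕ) : SimpleGraph (Fin (p + q - 1 + n)) :=
  SimpleGraph.fromRel (fun a b =>
    ((a : ℕ) + 1 = (b : ℕ) ∧ (b : ℕ) < p) ∨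
    ((a : ℕ) = 0 ∧ (b : ℕ) = p - 1) ∨
    ((a : ℕ) = 0 ∧ (b : ℕ) = p) ∨
    (p ≤ (a : ℕ) ∧ (a : ℕ) + 1 = (b : ℕ) ∧ (b : ℕ) ≤ p + q - 2) ∨
    ((a : ℕ) = 0 ∧ (b : ℕ) = p + q - 2) ∨
    (1 ≤ n ∧ (a : ℕ) = 0 ∧ (b : ℕ) = p + q - 1) ∨
    (p + q - 1 ≤ (a : ℕ) ∧ (a : ℕ) + 1 = (b : ℕ)))

namespace SimpleGraph

variable {V W : Type*}

/-- A map sending each edge to an edge or to a single vertex does not increase distances. -/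
theorem Connected.dist_map_le {G : SimpleGraph V} {H : SimpleGraph W} (hG : G.Connected)
    (f : V → W) (hf : ∀ x y, G.Adj x y → f x = f y ∨ H.Adj (f x) (f y)) (x y : V) :
    H.dist (f x) (f y) ≤ G.dist x y := by
  have key : ∀ {x y : V} (w : G.Walk x y), ∃ w' : H.Walk (f x) (f y), w'.length ≤ w.length := by
    intro x y w
    induction w with
    | nil => exact ⟨Walk.nil, le_rfl⟩
    | @cons u v _ h w ih =>
      obtain ⟨w', hw'⟩ := ih
      rcases hf _ _ h with h' | h'
      · exact ⟨w'.copy h'.symm rfl, by simp; omega⟩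
      · exact ⟨Walk.cons h' w', by simpa using hw'⟩
  obtain ⟨w, hw⟩ := hG.exists_walk_length_eq_dist x y
  obtain ⟨w', hw'⟩ := key w
  exact (dist_le w').trans (hw'.trans hw.le)

/-- If `c` separates the set `S` from the other vertices, then shortest paths leaving `S` run
through `c`. -/
theorem Connected.dist_eq_add_of_separates {G : SimpleGraph V} (hG : G.Connected) {S : Set V}
    {c : V} (hc : ∀ a ∈ S, ∀ y ∉ S, G.Adj a y → y = c) {a y : V} (ha : a ∈ S) (hy : y ∉ S) :
    G.dist a y = G.dist a c + G.dist c y := by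
  refine le_antisymm hG.dist_triangle ?_
  have key : ∀ {a y : V} (w : G.Walk a y), a ∈ S → y ∉ S →
      G.dist a c + G.dist c y ≤ w.length := by
    intro a y w
    induction w with
    | nil => intro h h'; exact absurd h h'
    | @cons u v y h w ih =>
      intro hu hy
      rw [Walk.length_cons]
      by_cases hv : v ∈ S
      · have h1 := ih hv hy
        have h2 : G.dist u c ≤ G.dist u v + G.dist v c := hG.dist_triangle
        rw [dist_eq_one_iff_adj.mpr h] at h2
        omega
      · obtain rfl := hc u hu v hv h
        have h1 := dist_le w
        rw [dist_eq_one_iff_adj.mpr h]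
        omega
  obtain ⟨w, hw⟩ := hG.exists_walk_length_eq_dist a y
  exact hw ▸ key w ha hy

end SimpleGraph

/-- The distance matrix with the constant `t` added to every entry. -/
noncomputable def shiftedDistMatrix {V : Type*} (G : SimpleGraph V) (t : ℚ) : Matrix V V ℚ :=
  fun i j => (G.dist i j : ℚ) + t

theorem shiftedDistMatrix_zero {V : Type*} (G : SimpleGraph V) :
    shiftedDistMatrix G 0 = distMatrix G := by
  ext i j
  simp [shiftedDistMatrix, distMatrix]

section Determinants

variable {V W : Type*} [Fintype V] [DecidableEq V] [Fintype W] [DecidableEq W]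

theorem det_shiftedDistMatrix_eq_of_iso {G : SimpleGraph V} {H : SimpleGraph W}
    (hG : G.Connected) (e : G ≃g H) (t : ℚ) :
    (shiftedDistMatrix G t).det = (shiftedDistMatrix H t).det := by
  have hH : H.Connected := e.connected_iff.mp hG
  rw [← Matrix.det_submatrix_equiv_self e.toEquiv (shiftedDistMatrix H t)]
  congr 1
  ext i j
  have h1 := hG.dist_map_le (H := H) e (fun x y h => Or.inr (e.map_adj_iff.mpr h)) i j
  have h2 := hH.dist_map_le (H := G) e.symm
    (fun x y h => Or.inr (e.symm.map_adj_iff.mpr h)) (e i) (e j)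
  simp only [RelIso.symm_apply_apply] at h2
  simp [shiftedDistMatrix, le_antisymm h2 h1]

/-- The simultaneous row and column operation subtracting index `b` from all indices in a set `S`
not containing `b` preserves the determinant. -/
theorem Matrix.det_sub_row_col (D : Matrix V V ℚ) (S : Set V) [DecidablePred (· ∈ S)] (b : V)
    (hb : b ∉ S) :
    (Matrix.of fun x y => D x y - (if x ∈ S then D b y else 0) - (if y ∈ S then D x b else 0) +
      (if x ∈ S then if y ∈ S then D b b else 0 else 0)).det = D.det := by
  set u : V → ℚ := fun x => if x ∈ S then -1 else 0 with hu
  set P : Matrix V V ℚ := 1 + Matrix.replicateCol Unit u * Matrix.replicateRow Unit (Pi.single b (1 : ℚ))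
    with hP
  have hdet : P.det = 1 := by
    rw [hP, Matrix.det_one_add_replicateCol_mul_replicateRow]
    simp [hu, hb]
  have hPapply : ∀ x z, P x z = (if x = z then 1 else 0) + u x * (if z = b then 1 else 0) := by
    intro x z
    simp [hP, Matrix.mul_apply, Matrix.one_apply, Pi.single_apply]
  have hM : (Matrix.of fun x y => D x y - (if x ∈ S then D b y else 0) -
      (if y ∈ S then D x b else 0) +
      (if x ∈ S then if y ∈ S then D b b else 0 else 0)) = P * D * P.transpose := by
    ext x y
    have h1 : ∀ z, (P * D) x z = D x z + u x * D b z := by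
      intro z
      simp [Matrix.mul_apply, hPapply, add_mul, Finset.sum_add_distrib, ite_mul]
    have h2 : (P * D * P.transpose) x y = (P * D) x y + u y * (P * D) x b := by
      rw [Matrix.mul_apply]
      simp [Matrix.transpose_apply, hPapply, mul_add, Finset.sum_add_distrib]
      ring
    rw [h2, h1, h1, Matrix.of_apply]
    simp only [hu]
    split_ifs <;> ring
  rw [hM, Matrix.det_mul, Matrix.det_mul, Matrix.det_transpose, hdet]
  ring

omit [Fintype V] [DecidableEq V] in
theorem dist_le_of_transplant {G H : SimpleGraph V} (hG : G.Connected)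
    {S : Set V} {c d : V}
    (hGc : ∀ a ∈ S, ∀ y ∉ S, G.Adj a y → y = c)
    (hin : ∀ x ∈ S, ∀ y ∈ S, G.Adj x y → H.Adj x y)
    (hbd : ∀ x ∈ S, G.Adj x c → H.Adj x d) :
    (∀ x ∈ S, ∀ y ∈ S, H.dist x y ≤ G.dist x y) ∧ ∀ x ∈ S, c ∉ S → H.dist x d ≤ G.dist x c := by
  classical
  have key := hG.dist_map_le (H := H) (fun x => if x ∈ S then x else d) (by
    intro x y h
    by_cases hx : x ∈ S <;> by_cases hy : y ∈ S <;> simp only [hx, hy, if_true, if_false]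
    · exact Or.inr (hin x hx y hy h)
    · obtain rfl := hGc x hx y hy h
      exact Or.inr (hbd x hx h)
    · obtain rfl := hGc y hy x hx h.symm
      exact Or.inr (hbd y hy h.symm).symm
    · exact Or.inl trivial)
  refine ⟨fun x hx y hy => ?_, fun x hx hc => ?_⟩
  · simpa [hx, hy] using key x y
  · simpa [hx, hc] using key x c

omit [Fintype V] [DecidableEq V] in
theorem dist_le_of_transplant_compl {G H : SimpleGraph V} (hG : G.Connected)
    {S : Set V} {c : V} (hGc : ∀ a ∈ S, ∀ y ∉ S, G.Adj a y → y = c)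
    (hout : ∀ x ∉ S, ∀ y ∉ S, G.Adj x y → H.Adj x y) :
    ∀ x ∉ S, ∀ y ∉ S, H.dist x y ≤ G.dist x y := by
  classical
  have key := hG.dist_map_le (H := H) (fun x => if x ∈ S then c else x) (by
    intro x y h
    by_cases hx : x ∈ S <;> by_cases hy : y ∈ S <;> simp only [hx, hy, if_true, if_false]
    · exact Or.inl trivial
    · exact Or.inl (hGc x hx y hy h).symm
    · exact Or.inl (hGc y hy x hx h.symm)
    · exact Or.inr (hout x hx y hy h))
  intro x hx y hy
  simpa [hx, hy] using key x y

/-- Moving a piece `S` of a graph, attached to the rest through a single vertex `c`, to another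
vertex `d` of the rest preserves the determinant of the shifted distance matrix. -/
theorem det_shiftedDistMatrix_eq_of_transplant {G H : SimpleGraph V} (hG : G.Connected)
    (hH : H.Connected) {S : Set V} {c d : V} (hcS : c ∉ S) (hdS : d ∉ S)
    (hGc : ∀ a ∈ S, ∀ y ∉ S, G.Adj a y → y = c)
    (hHd : ∀ a ∈ S, ∀ y ∉ S, H.Adj a y → y = d)
    (hin : ∀ x ∈ S, ∀ y ∈ S, (G.Adj x y ↔ H.Adj x y))
    (hout : ∀ x ∉ S, ∀ y ∉ S, (G.Adj x y ↔ H.Adj x y))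
    (hbd : ∀ x ∈ S, (G.Adj x c ↔ H.Adj x d)) (t : ℚ) :
    (shiftedDistMatrix G t).det = (shiftedDistMatrix H t).det := by
  classical
  obtain ⟨l1, l2⟩ := dist_le_of_transplant hG hGc (fun x hx y hy => (hin x hx y hy).mp)
    (fun x hx => (hbd x hx).mp)
  obtain ⟨r1, r2⟩ := dist_le_of_transplant hH hHd (fun x hx y hy => (hin x hx y hy).mpr)
    (fun x hx => (hbd x hx).mpr)
  have l3 := dist_le_of_transplant_compl hG hGc (fun x hx y hy => (hout x hx y hy).mp)
  have r3 := dist_le_of_transplant_compl hH hHd (fun x hx y hy => (hout x hx y hy).mpr)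
  have e1 : ∀ x ∈ S, ∀ y ∈ S, G.dist x y = H.dist x y :=
    fun x hx y hy => le_antisymm (r1 x hx y hy) (l1 x hx y hy)
  have e2 : ∀ x ∈ S, G.dist x c = H.dist x d :=
    fun x hx => le_antisymm (r2 x hx hdS) (l2 x hx hcS)
  have e3 : ∀ x ∉ S, ∀ y ∉ S, G.dist x y = H.dist x y :=
    fun x hx y hy => le_antisymm (r3 x hx y hy) (l3 x hx y hy)
  have s1 : ∀ x ∈ S, ∀ y ∉ S, G.dist x y = G.dist x c + G.dist c y :=
    fun x hx y hy => hG.dist_eq_add_of_separates hGc hx hy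
  have s2 : ∀ x ∈ S, ∀ y ∉ S, H.dist x y = H.dist x d + H.dist d y :=
    fun x hx y hy => hH.dist_eq_add_of_separates hHd hx hy
  rw [← Matrix.det_sub_row_col (shiftedDistMatrix G t) S c hcS,
    ← Matrix.det_sub_row_col (shiftedDistMatrix H t) S d hdS]
  congr 1
  ext x y
  simp only [Matrix.of_apply, shiftedDistMatrix]
  by_cases hx : x ∈ S <;> by_cases hy : y ∈ S <;>
    simp only [hx, hy, if_true, if_false, dist_self]
  · rw [e1 x hx y hy, dist_comm (u := c), dist_comm (u := d), e2 x hx, e2 y hy]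
  · rw [s1 x hx y hy, s2 x hx y hy, e2 x hx]
    push_cast
    ring
  · rw [dist_comm (u := x) (v := y), dist_comm (u := x) (v := c), dist_comm (u := x) (v := y),
      dist_comm (u := x) (v := d), s1 y hy x hx, s2 y hy x hx, e2 y hy]
    push_cast
    ring
  · rw [e3 x hx y hy]

/-- Deleting a leaf `v` from a connected graph. -/
theorem det_shiftedDistMatrix_of_leaf {G : SimpleGraph V} {H : SimpleGraph W} (hG : G.Connected)
    (hH : H.Connected) (φ : H ↪g G) {v : V} (hv : ∀ x, x ∉ Set.range φ ↔ x = v) {u : V}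
    (huv : G.Adj v u) (hu : ∀ w, G.Adj v w → w = u) (t : ℚ) :
    (shiftedDistMatrix G t).det = -2 * (shiftedDistMatrix H (t + 1 / 2)).det := by
  classical
  have hne : u ≠ v := huv.ne'
  have hvr : ∀ x, φ x ≠ v := fun x h => (hv v).mpr rfl ⟨x, h⟩
  have hbij : Function.Bijective (Sum.elim φ (fun _ : Unit => v)) := by
    refine ⟨?_, ?_⟩
    · rintro (x | x) (y | y) h
      · exact congrArg _ (φ.injective h)
      · exact absurd h (hvr x)
      · exact absurd h.symm (hvr y)
      · rfl
    · intro x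
      by_cases hx : x = v
      · exact ⟨Sum.inr (), hx.symm⟩
      · obtain ⟨y, hy⟩ := not_not.mp (mt (hv x).mp hx)
        exact ⟨Sum.inl y, hy⟩
  obtain ⟨u', rfl⟩ := not_not.mp (mt (hv u).mp hne)
  have : Nonempty W := ⟨u'⟩
  have hdist : ∀ x y, G.dist (φ x) (φ y) = H.dist x y := by
    intro x y
    refine le_antisymm
      (hH.dist_map_le φ (fun x y h => Or.inr (φ.map_adj_iff.mpr h)) x y) ?_
    have hinv : ∀ x, Function.invFun φ (φ x) = x := Function.leftInverse_invFun φ.injective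
    have key := hG.dist_map_le (H := H) (fun x => if x = v then u' else Function.invFun φ x) (by
      intro x y h
      by_cases hx : x = v <;> by_cases hy : y = v <;> simp only [hx, hy, if_true, if_false]
      · exact Or.inl trivial
      · subst hx
        rw [hu y h, hinv]
        exact Or.inl rfl
      · subst hy
        rw [hu x h.symm, hinv]
        exact Or.inl rfl
      · obtain ⟨x, rfl⟩ := not_not.mp (mt (hv x).mp hx)
        obtain ⟨y, rfl⟩ := not_not.mp (mt (hv y).mp hy)
        rw [hinv, hinv]
        exact Or.inr (φ.map_adj_iff.mp h)) (φ x) (φ y)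
    simpa [hvr, hinv] using key
  have hsep : ∀ y, y ≠ v → G.dist v y = 1 + G.dist (φ u') y := by
    intro y hy
    rw [hG.dist_eq_add_of_separates (S := {v}) (c := φ u') (by simpa using fun y _ h => hu y h)
      rfl (by simpa using hy), dist_eq_one_iff_adj.mpr huv]
  rw [← Matrix.det_sub_row_col (shiftedDistMatrix G t) {v} (φ u') (by simpa using hne),
    ← Matrix.det_submatrix_equiv_self (Equiv.ofBijective _ hbij)]
  have hblock : (Matrix.of fun x y => shiftedDistMatrix G t x y -
      (if x ∈ ({v} : Set V) then shiftedDistMatrix G t (φ u') y else 0) -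
      (if y ∈ ({v} : Set V) then shiftedDistMatrix G t x (φ u') else 0) +
      (if x ∈ ({v} : Set V) then if y ∈ ({v} : Set V) then
        shiftedDistMatrix G t (φ u') (φ u') else 0 else 0)).submatrix
      (Equiv.ofBijective _ hbij) (Equiv.ofBijective _ hbij) =
      Matrix.fromBlocks (shiftedDistMatrix H t) (Matrix.of fun _ _ => 1) (Matrix.of fun _ _ => 1)
        (Matrix.of fun _ _ : Unit => -2) := by
    ext (x | x) (y | y)
    · simp [shiftedDistMatrix, hvr, hdist]
    · simp [shiftedDistMatrix, hvr, dist_comm (v := v), dist_comm (v := φ u'), hsep]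
    · simp [shiftedDistMatrix, hvr, hsep]
    · simp [shiftedDistMatrix, dist_comm (v := v), dist_eq_one_iff_adj.mpr huv]
      ring
  rw [hblock]
  let _ : Invertible (Matrix.of fun _ _ => -2 : Matrix Unit Unit ℚ) :=
    ⟨Matrix.of fun _ _ => -1 / 2, by ext; norm_num [Matrix.mul_apply],
      by ext; norm_num [Matrix.mul_apply]⟩
  rw [Matrix.det_fromBlocks₂₂]
  congr 1
  · simp
  · congr 1
    ext x y
    have : (⅟ (Matrix.of fun _ _ => -2 : Matrix Unit Unit ℚ)) =
        Matrix.of fun _ _ => -1 / 2 := rfl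
    simp [Matrix.mul_apply, this, shiftedDistMatrix]
    ring

end Determinants

/-- A graph has a vertex of degree one outside an induced subgraph if it has too few edges. -/
theorem exists_degree_eq_one_of_embedding {U V : Type*} [Fintype U] [Fintype V]
    {K : SimpleGraph U} {G : SimpleGraph V} [DecidableRel K.Adj] [DecidableRel G.Adj]
    [Nonempty U] (hG : G.Connected) (φ : K ↪g G)
    (hK : Fintype.card U + 1 ≤ K.edgeFinset.card)
    (hE : G.edgeFinset.card ≤ Fintype.card V + 1) (hφ : ∃ v, v ∉ Set.range φ) :
    ∃ v, v ∉ Set.range φ ∧ G.degree v = 1 := by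
  classical
  by_contra! hcon
  obtain ⟨v₀, hv₀⟩ := hφ
  obtain ⟨u₀⟩ := ‹Nonempty U›
  have : Nontrivial V := ⟨φ u₀, v₀, fun h => hv₀ ⟨u₀, h⟩⟩
  have hout : ∀ v, v ∉ Set.range φ → 2 ≤ G.degree v := by
    intro v hv
    have h1 := hG.preconnected.degree_pos_of_nontrivial v
    have h2 := hcon v hv
    omega
  have hsub : ∀ u, (K.neighborFinset u).map φ.toEmbedding ⊆ G.neighborFinset (φ u) := by
    intro u x hx
    obtain ⟨y, hy, rfl⟩ := Finset.mem_map.mp hx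
    rw [mem_neighborFinset] at hy ⊢
    exact φ.map_adj_iff.mpr hy
  have hle : ∀ u, K.degree u ≤ G.degree (φ u) := by
    intro u
    have := Finset.card_le_card (hsub u)
    rwa [Finset.card_map] at this
  have hlt : ∃ u, K.degree u < G.degree (φ u) := by
    obtain ⟨w⟩ := hG.preconnected (φ u₀) v₀
    obtain ⟨d, -, ⟨u, hu⟩, hd⟩ := w.exists_boundary_dart (Set.range φ) ⟨u₀, rfl⟩ hv₀
    refine ⟨u, ?_⟩
    have := Finset.card_lt_card ((Finset.ssubset_iff_of_subset (hsub u)).mpr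
      ⟨d.snd, by rw [mem_neighborFinset, hu]; exact d.adj, fun h => ?_⟩)
    · rwa [Finset.card_map] at this
    · obtain ⟨y, -, hy⟩ := Finset.mem_map.mp h
      exact hd ⟨y, hy⟩
  have hsum : ∑ u, K.degree u < ∑ u, G.degree (φ u) := by
    obtain ⟨u, hu⟩ := hlt
    exact Finset.sum_lt_sum (fun u _ => hle u) ⟨u, Finset.mem_univ _, hu⟩
  have hsplit := Finset.sum_add_sum_compl (Finset.univ.map φ.toEmbedding) (fun v => G.degree v)
  rw [Finset.sum_map, G.sum_degrees_eq_twice_card_edges] at hsplit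
  rw [K.sum_degrees_eq_twice_card_edges] at hsum
  have hcompl : (Finset.univ.map φ.toEmbedding)ᶜ.card * 2 ≤
      ∑ v ∈ (Finset.univ.map φ.toEmbedding)ᶜ, G.degree v := by
    refine Finset.card_nsmul_le_sum _ _ _ fun v hv => hout v ?_
    rintro ⟨y, rfl⟩
    simp at hv
  have hcard := Finset.card_add_card_compl (Finset.univ.map φ.toEmbedding)
  rw [Finset.card_map, Finset.card_univ] at hcard
  have e : ∑ x, G.degree (φ.toEmbedding x) = ∑ x, G.degree (φ x) := rfl
  omega

theorem connected_of_exists_lt_adj {N : ℕ} (hN : 0 < N) (G : SimpleGraph (Fin N))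
    (h : ∀ x : Fin N, 0 < (x : ℕ) → ∃ y, y < x ∧ G.Adj y x) : G.Connected := by
  have key : ∀ m, ∀ hm : m < N, G.Reachable ⟨0, hN⟩ ⟨m, hm⟩ := by
    intro m
    induction m using Nat.strong_induction_on with
    | _ m ih =>
      intro hm
      rcases Nat.eq_zero_or_pos m with rfl | hpos
      · exact Reachable.refl _
      · obtain ⟨y, hy, hadj⟩ := h ⟨m, hm⟩ hpos
        exact (ih y hy y.isLt).trans hadj.reachable
  have : Nonempty (Fin N) := ⟨⟨0, hN⟩⟩
  exact ⟨fun x y => (key x x.isLt).symm.trans (key y y.isLt)⟩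

section InftyGraphs

variable {p q k n : ℕ}

theorem inftyGraph_adj_of_lt (hp : 3 ≤ p) (hq : 3 ≤ q) (hk : 1 ≤ k)
    {a b : Fin (p + q + k - 2)} (hab : (a : ℕ) < b) :
    (inftyGraph p k q).Adj a b ↔ ((b : ℕ) = p ∧ (a : ℕ) = 0) ∨ ((b : ℕ) ≠ p ∧ (a : ℕ) + 1 = b) ∨
      ((b : ℕ) + 1 = p ∧ (a : ℕ) = 0) ∨
      ((b : ℕ) + 3 = p + q + k ∧ (a : ℕ) = if k = 1 then 0 else p + k - 2) := by
  have hb := b.isLt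
  rw [inftyGraph, fromRel_adj, ne_eq, Fin.ext_iff]
  generalize (a : ℕ) = a at *
  generalize (b : ℕ) = b at *
  constructor
  · rintro ⟨-, (h | h | h | h | h | h | h) | (h | h | h | h | h | h | h)⟩ <;>
      split_ifs at * <;> omega
  · intro h
    refine ⟨hab.ne, Or.inl ?_⟩
    rcases h with h | h | h | h
    · by_cases hk1 : k = 1
      · exact Or.inr (Or.inr (Or.inr (Or.inr (Or.inl ⟨by rw [if_pos hk1]; omega, by omega⟩))))
      · exact Or.inr (Or.inr (Or.inl (by omega)))
    · by_cases h1 : b < p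
      · exact Or.inl ⟨h.2, h1⟩
      by_cases h2 : b ≤ p + k - 2
      · exact Or.inr (Or.inr (Or.inr (Or.inl (by omega))))
      by_cases h3 : b = p + k - 1
      · refine Or.inr (Or.inr (Or.inr (Or.inr (Or.inl ⟨?_, h3⟩))))
        rw [if_neg (by omega)]
        omega
      · exact Or.inr (Or.inr (Or.inr (Or.inr (Or.inr (Or.inr (by omega))))))
    · exact Or.inr (Or.inl (by omega))
    · exact Or.inr (Or.inr (Or.inr (Or.inr (Or.inr (Or.inl ⟨h.2, by omega⟩)))))

theorem inftyGraph_adj (hp : 3 ≤ p) (hq : 3 ≤ q) (hk : 1 ≤ k) {a b : Fin (p + q + k - 2)} :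
    (inftyGraph p k q).Adj a b ↔
      ((a : ℕ) < b ∧ (((b : ℕ) = p ∧ (a : ℕ) = 0) ∨ ((b : ℕ) ≠ p ∧ (a : ℕ) + 1 = b) ∨
        ((b : ℕ) + 1 = p ∧ (a : ℕ) = 0) ∨
        ((b : ℕ) + 3 = p + q + k ∧ (a : ℕ) = if k = 1 then 0 else p + k - 2))) ∨
      ((b : ℕ) < a ∧ (((a : ℕ) = p ∧ (b : ℕ) = 0) ∨ ((a : ℕ) ≠ p ∧ (b : ℕ) + 1 = a) ∨
        ((a : ℕ) + 1 = p ∧ (b : ℕ) = 0) ∨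
        ((a : ℕ) + 3 = p + q + k ∧ (b : ℕ) = if k = 1 then 0 else p + k - 2))) := by
  rcases lt_trichotomy (a : ℕ) b with h | h | h
  · simp only [inftyGraph_adj_of_lt hp hq hk h, h, h.not_gt, true_and, false_and, or_false]
  · simp only [Fin.ext h, (inftyGraph p k q).irrefl, lt_irrefl, false_and, or_false]
  · rw [adj_comm]
    simp only [inftyGraph_adj_of_lt hp hq hk h, h, h.not_gt, true_and, false_and, false_or]

theorem Gpq_adj_of_lt (hp : 3 ≤ p) (hq : 3 ≤ q) {a b : Fin (p + q - 1 + n)}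
    (hab : (a : ℕ) < b) :
    (Gpq p q n).Adj a b ↔ (((b : ℕ) = p ∨ (b : ℕ) + 1 = p + q) ∧ (a : ℕ) = 0) ∨
      ((b : ℕ) ≠ p ∧ (b : ℕ) + 1 ≠ p + q ∧ (a : ℕ) + 1 = b) ∨
      ((b : ℕ) + 1 = p ∧ (a : ℕ) = 0) ∨ ((b : ℕ) + 2 = p + q ∧ (a : ℕ) = 0) := by
  have hb := b.isLt
  rw [Gpq, fromRel_adj, ne_eq, Fin.ext_iff]
  generalize (a : ℕ) = a at *
  generalize (b : ℕ) = b at *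
  constructor
  · rintro ⟨-, (h | h | h | h | h | h | h) | (h | h | h | h | h | h | h)⟩ <;> omega
  · intro h
    refine ⟨hab.ne, Or.inl ?_⟩
    omega

theorem Gpq_adj (hp : 3 ≤ p) (hq : 3 ≤ q) {a b : Fin (p + q - 1 + n)} :
    (Gpq p q n).Adj a b ↔
      ((a : ℕ) < b ∧ ((((b : ℕ) = p ∨ (b : ℕ) + 1 = p + q) ∧ (a : ℕ) = 0) ∨
        ((b : ℕ) ≠ p ∧ (b : ℕ) + 1 ≠ p + q ∧ (a : ℕ) + 1 = b) ∨
        ((b : ℕ) + 1 = p ∧ (a : ℕ) = 0) ∨ ((b : ℕ) + 2 = p + q ∧ (a : ℕ) = 0))) ∨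
      ((b : ℕ) < a ∧ ((((a : ℕ) = p ∨ (a : ℕ) + 1 = p + q) ∧ (b : ℕ) = 0) ∨
        ((a : ℕ) ≠ p ∧ (a : ℕ) + 1 ≠ p + q ∧ (b : ℕ) + 1 = a) ∨
        ((a : ℕ) + 1 = p ∧ (b : ℕ) = 0) ∨ ((a : ℕ) + 2 = p + q ∧ (b : ℕ) = 0))) := by
  rcases lt_trichotomy (a : ℕ) b with h | h | h
  · simp only [Gpq_adj_of_lt hp hq h, h, h.not_gt, true_and, false_and, or_false]
  · simp only [Fin.ext h, (Gpq p q n).irrefl, lt_irrefl, false_and, or_false]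
  · rw [adj_comm]
    simp only [Gpq_adj_of_lt hp hq h, h, h.not_gt, true_and, false_and, false_or]

theorem inftyGraph_connected_s2 (hp : 3 ≤ p) (hq : 3 ≤ q) (hk : 1 ≤ k) :
    (inftyGraph p k q).Connected := by
  refine connected_of_exists_lt_adj (by omega) _ fun x hx => ?_
  have hx' := x.isLt
  have hlt : (if (x : ℕ) = p then 0 else (x : ℕ) - 1) < x := by split_ifs <;> omega
  refine ⟨⟨if (x : ℕ) = p then 0 else x - 1, hlt.trans hx'⟩, hlt, ?_⟩
  rw [inftyGraph_adj_of_lt hp hq hk hlt]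
  dsimp only
  split_ifs <;> omega

theorem Gpq_connected (hp : 3 ≤ p) (hq : 3 ≤ q) : (Gpq p q n).Connected := by
  refine connected_of_exists_lt_adj (by omega) _ fun x hx => ?_
  have hx' := x.isLt
  have hlt : (if (x : ℕ) = p ∨ (x : ℕ) + 1 = p + q then 0 else (x : ℕ) - 1) < x := by
    split_ifs <;> omega
  refine ⟨⟨if (x : ℕ) = p ∨ (x : ℕ) + 1 = p + q then 0 else x - 1, hlt.trans hx'⟩, hlt, ?_⟩
  rw [Gpq_adj_of_lt hp hq hlt]
  dsimp only
  split_ifs <;> omega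

theorem le_card_edgeFinset_inftyGraph (hp : 3 ≤ p) (hq : 3 ≤ q) (hk : 1 ≤ k)
    [DecidableRel (inftyGraph p k q).Adj] :
    p + q + k - 2 + 1 ≤ (inftyGraph p k q).edgeFinset.card := by
  obtain ⟨N, hN⟩ : ∃ N, N = p + q + k - 2 := ⟨_, rfl⟩
  set lo : ℕ → ℕ := fun i => if i + 1 < N then (if i + 1 = p then 0 else i) else
    if i + 1 = N then 0 else (if k = 1 then 0 else p + k - 2) with hlo
  set hi : ℕ → ℕ := fun i => if i + 1 < N then i + 1 else if i + 1 = N then p - 1 else N - 1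
    with hhi
  have hlt : ∀ i, lo i < hi i := by
    intro i
    simp only [hlo, hhi]
    split_ifs <;> omega
  have hbd : ∀ i, hi i < p + q + k - 2 := by
    intro i
    simp only [hhi]
    split_ifs <;> omega
  have key := Finset.card_le_card_of_injOn (s := Finset.range (N + 1))
    (t := (inftyGraph p k q).edgeFinset)
    (fun i => s(⟨lo i, (hlt i).trans (hbd i)⟩, ⟨hi i, hbd i⟩)) ?_ ?_
  · simpa [hN] using key
  · intro i hi'
    have hi'' : i < N + 1 := by simpa using hi'
    rw [Finset.mem_coe, mem_edgeFinset, mem_edgeSet, inftyGraph_adj_of_lt hp hq hk (hlt i)]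
    simp only [hlo, hhi]
    split_ifs <;> omega
  · intro i hi' j hj' hij
    have hi'' : i < N + 1 := by simpa using hi'
    have hj'' : j < N + 1 := by simpa using hj'
    have h1 := hlt i
    have h2 := hlt j
    simp only [Sym2.eq_iff, Fin.mk.injEq] at hij
    have h3 : lo i = lo j ∧ hi i = hi j := by omega
    simp only [hlo, hhi] at h3
    split_ifs at h3 <;> omega

theorem det_shiftedDistMatrix_Gpq_succ (hp : 3 ≤ p) (hq : 3 ≤ q) (t : ℚ) :
    (shiftedDistMatrix (Gpq p q (n + 1)) t).det =
      -2 * (shiftedDistMatrix (Gpq p q n) (t + 1 / 2)).det := by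
  let φ : Gpq p q n ↪g Gpq p q (n + 1) :=
    { toFun := Fin.castSucc
      inj' := Fin.castSucc_injective _
      map_rel_iff' := by
        intro x y
        rw [Gpq_adj hp hq, Gpq_adj hp hq]
        rfl }
  refine det_shiftedDistMatrix_of_leaf (Gpq_connected hp hq) (Gpq_connected hp hq) φ
    (v := ⟨p + q - 1 + n, by omega⟩)
    (u := ⟨if n = 0 then 0 else p + q - 1 + n - 1, by split_ifs <;> omega⟩) ?_ ?_ ?_ t
  · intro x
    have hx := x.isLt
    rw [Fin.ext_iff]
    constructor
    · intro h
      by_contra hne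
      dsimp only at hne
      exact h ⟨⟨x, by omega⟩, rfl⟩
    · rintro h ⟨y, rfl⟩
      have hy := y.isLt
      have : ((φ y : Fin _) : ℕ) = y := rfl
      dsimp only at h
      omega
  · rw [Gpq_adj hp hq]
    dsimp only
    split_ifs <;> omega
  · intro w hw
    have hw' := w.isLt
    rw [Gpq_adj hp hq] at hw
    rw [Fin.ext_iff]
    dsimp only at hw ⊢
    split_ifs <;> omega

theorem det_shiftedDistMatrix_inftyGraph (hp : 3 ≤ p) (hq : 3 ≤ q) (hk : 1 ≤ k) (t : ℚ) :
    (shiftedDistMatrix (inftyGraph p k q) t).det =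
      (shiftedDistMatrix (Gpq p q (k - 1)) t).det := by
  set s : ℕ → ℕ := fun x => if x < p then x else if x + 1 < p + k then x + q - 1 else x + 1 - k
    with hs
  have hbd : ∀ x, x < p + q + k - 2 → s x < p + q - 1 + (k - 1) := by
    intro x hx
    simp only [hs]
    split_ifs <;> omega
  have hinj : ∀ x y, x < p + q + k - 2 → y < p + q + k - 2 → s x = s y → x = y := by
    intro x y hx hy hxy
    simp only [hs] at hxy
    split_ifs at hxy <;> omega
  let f : Fin (p + q + k - 2) → Fin (p + q - 1 + (k - 1)) := fun x => ⟨s x, hbd x x.isLt⟩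
  have hf : Function.Bijective f := by
    rw [Fintype.bijective_iff_injective_and_card]
    refine ⟨fun x y h => Fin.ext (hinj x y x.isLt y.isLt (Fin.ext_iff.mp h)), ?_⟩
    simp only [Fintype.card_fin]
    omega
  let σ : (Gpq p q (k - 1)).comap f ≃g Gpq p q (k - 1) :=
    { toEquiv := Equiv.ofBijective f hf
      map_rel_iff' := by simp }
  have hconn : ((Gpq p q (k - 1)).comap f).Connected :=
    σ.connected_iff.mpr (Gpq_connected hp hq)
  have hS1 : ∀ x, p + k ≤ x + 1 → s x = x + 1 - k := by
    intro x hx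
    simp only [hs]
    split_ifs <;> omega
  have hS2 : ∀ x, ¬ p + k ≤ x + 1 → s x = if x < p then x else x + q - 1 := by
    intro x hx
    simp only [hs]
    split_ifs <;> omega
  have hs0 : s 0 = 0 := if_pos (by omega)
  clear_value s
  rw [← det_shiftedDistMatrix_eq_of_iso hconn σ]
  refine det_shiftedDistMatrix_eq_of_transplant (inftyGraph_connected_s2 hp hq hk) hconn
    (S := {x | p + k ≤ (x : ℕ) + 1})
    (c := ⟨if k = 1 then 0 else p + k - 2, by split_ifs <;> omega⟩)
    (d := ⟨0, by omega⟩) ?_ ?_ ?_ ?_ ?_ ?_ ?_ t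
  · rw [Set.mem_ofPred_eq]
    dsimp only
    split_ifs <;> omega
  · rw [Set.mem_ofPred_eq]
    dsimp only
    omega
  · intro a ha y hy h
    have ha' := a.isLt
    rw [Set.mem_ofPred_eq] at ha hy
    rw [inftyGraph_adj hp hq hk] at h
    rw [Fin.ext_iff]
    dsimp only
    split_ifs at * <;> omega
  · intro a ha y hy h
    have ha' := a.isLt
    rw [Set.mem_ofPred_eq] at ha hy
    rw [comap_adj, Gpq_adj hp hq] at h
    rw [Fin.ext_iff]
    dsimp only [f] at h ⊢
    rw [hS1 _ ha, hS2 _ hy] at h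
    split_ifs at h <;> omega
  · intro a ha y hy
    wlog hay : (a : ℕ) < y generalizing a y
    · rcases (not_lt.mp hay).lt_or_eq with h | h
      · rw [adj_comm, adj_comm _ a y]
        exact this y hy a ha h
      · rw [Fin.ext h]
        simp only [SimpleGraph.irrefl]
    rw [Set.mem_ofPred_eq] at ha hy
    have hlt : s a < s y := by
      rw [hS1 _ ha, hS1 _ hy]
      omega
    have hy' := y.isLt
    rw [comap_adj, Gpq_adj_of_lt hp hq hlt, inftyGraph_adj_of_lt hp hq hk hay]
    dsimp only [f]
    rw [hS1 _ ha, hS1 _ hy]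
    generalize (a : ℕ) = a at *
    generalize (y : ℕ) = y at *
    constructor
    · rintro (h | h | h | h) <;> (try split_ifs at h) <;> omega
    · rintro (h | h | h | h) <;> (try split_ifs) <;> omega
  · intro a ha y hy
    wlog hay : (a : ℕ) < y generalizing a y
    · rcases (not_lt.mp hay).lt_or_eq with h | h
      · rw [adj_comm, adj_comm _ a y]
        exact this y hy a ha h
      · rw [Fin.ext h]
        simp only [SimpleGraph.irrefl]
    rw [Set.mem_ofPred_eq] at ha hy
    have hlt : s a < s y := by
      rw [hS2 _ ha, hS2 _ hy]
      split_ifs <;> omega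
    rw [comap_adj, Gpq_adj_of_lt hp hq hlt, inftyGraph_adj_of_lt hp hq hk hay]
    dsimp only [f]
    rw [hS2 _ ha, hS2 _ hy]
    have hk' : ¬ (y : ℕ) + 3 = p + q + k := by omega
    simp only [hk', false_and, or_false]
    generalize (a : ℕ) = a at *
    generalize (y : ℕ) = y at *
    constructor
    · rintro (h | h | h) <;> split_ifs <;> omega
    · intro h
      split_ifs at h <;> omega
  · intro a ha
    have ha' := a.isLt
    rw [Set.mem_ofPred_eq] at ha
    rw [comap_adj, Gpq_adj hp hq, inftyGraph_adj hp hq hk]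
    dsimp only [f]
    rw [hS1 _ ha, hs0]
    split_ifs <;> omega

/-- A bicyclic graph with `m` vertices outside an induced `∞`-graph. -/
theorem det_shiftedDistMatrix_of_bicyclic (hp : 3 ≤ p) (hq : 3 ≤ q) (hk : 1 ≤ k) :
    ∀ (m : ℕ) (V : Type*) [Fintype V] [DecidableEq V] (G : SimpleGraph V), G.Connected →
      Fintype.card V = p + q + k - 2 + m → G.edgeSet.ncard = Fintype.card V + 1 →
      Nonempty (inftyGraph p k q ↪g G) → ∀ t : ℚ,
      (shiftedDistMatrix G t).det = (shiftedDistMatrix (Gpq p q (k - 1 + m)) t).det := by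
  classical
  intro m
  induction m with
  | zero =>
    rintro V _ _ G hG hcard - ⟨φ⟩ t
    have hbij : Function.Bijective φ := by
      rw [Fintype.bijective_iff_injective_and_card]
      exact ⟨φ.injective, by rw [Fintype.card_fin, hcard, add_zero]⟩
    have e : inftyGraph p k q ≃g G := ⟨Equiv.ofBijective φ hbij, φ.map_rel_iff'⟩
    rw [← det_shiftedDistMatrix_eq_of_iso (inftyGraph_connected_s2 hp hq hk) e,
      det_shiftedDistMatrix_inftyGraph hp hq hk, add_zero]
  | succ m ih =>
    rintro V _ _ G hG hcard hE ⟨φ⟩ t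
    rw [Set.ncard_eq_toFinset_card'] at hE
    have : Nonempty (Fin (p + q + k - 2)) := ⟨⟨0, by omega⟩⟩
    obtain ⟨v, hv, hdeg⟩ := exists_degree_eq_one_of_embedding hG φ
      (by rw [Fintype.card_fin]; exact le_card_edgeFinset_inftyGraph hp hq hk) hE.le (by
        by_contra! hsurj
        have := Fintype.card_le_of_surjective φ hsurj
        rw [Fintype.card_fin] at this
        omega)
    have hconn := hG.induce_compl_singleton_of_degree_eq_one hdeg
    have hcard' : Fintype.card ({v}ᶜ : Set V) = p + q + k - 2 + m := by
      rw [Fintype.card_compl_set, Set.card_singleton, hcard]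
      omega
    have hE' : (G.induce {v}ᶜ).edgeSet.ncard = Fintype.card ({v}ᶜ : Set V) + 1 := by
      rw [Set.ncard_eq_toFinset_card']
      have h1 := G.card_edgeFinset_induce_compl_singleton v
      rw [card_edgeFinset_deleteIncidenceSet, hdeg] at h1
      change (G.induce {v}ᶜ).edgeFinset.card = _
      change G.edgeFinset.card = _ at hE
      omega
    let ψ : inftyGraph p k q ↪g G.induce {v}ᶜ :=
      { toFun := fun x => ⟨φ x, fun h => hv ⟨x, h⟩⟩
        inj' := fun x y h => φ.injective (congrArg Subtype.val h)
        map_rel_iff' := φ.map_rel_iff' }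
    obtain ⟨u, hu, huniq⟩ := degree_eq_one_iff_existsUnique_adj.mp hdeg
    rw [det_shiftedDistMatrix_of_leaf hG hconn (Embedding.induce {v}ᶜ) (v := v) (by simp) hu huniq,
      ih _ _ hconn hcard' hE' ⟨ψ⟩,
      ← det_shiftedDistMatrix_Gpq_succ hp hq]
    rfl

end InftyGraphs

/-- If `G` is a bicyclic graph on `p+q-1+n` vertices (`p, q ≥ 3`, `k ≥ 1`,
`n ≥ k-1`) containing an induced subgraph isomorphic to `∞(p,k,q)`, then the
distance matrices of `G` and of `G(p,q;n)` have the same determinant. -/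
theorem det_distMatrix_eq_det_distMatrix_Gpq {V : Type*} [Fintype V] [DecidableEq V]
    (p q k n : ℕ) (hp : 3 ≤ p) (hq : 3 ≤ q) (hk : 1 ≤ k) (hn : k - 1 ≤ n)
    (G : SimpleGraph V) (hconn : G.Connected)
    (hcard : Fintype.card V = p + q - 1 + n)
    (hbicyclic : G.edgeSet.ncard = Fintype.card V + 1)
    (hsub : Nonempty (inftyGraph p k q ↪g G)) :
    (distMatrix G).det = (distMatrix (Gpq p q n)).det := by
  rw [← shiftedDistMatrix_zero, ← shiftedDistMatrix_zero,
    det_shiftedDistMatrix_of_bicyclic hp hq hk (n - (k - 1)) V G hconn (by omega) hbicyclic hsub,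
    show k - 1 + (n - (k - 1)) = n by omega]
end
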